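/- arXiv:1412.8295 — 2 statements merged into one kernel-verified Lean document; each statement's English description precedes it below -/
import Mathlib

section
/- Suppose $c_1=c_2=2$. For $\tilde\nu_q$-almost every $x\in[0,1]$, $\liminf_{r\to0}\frac{\log\nu(B(x,r))}{\log r}=\liminf_{n\to\infty}\frac{\log\nu(I_n(x))}{-n\log 2}$ and $\limsup_{r\to0}\frac{\log\nu(B(x,r))}{\log r}=\limsup_{n\to\infty}\frac{\log\nu(I_n(x))}{-n\log 2}$. -/
open MeasureTheory Metric Set Filter Topology Classical
open scoped ENNReal NNReal

noncomputable section

namespace MF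

/-! ### Olsen's multifractal measures and dimension functions on a metric space -/

variable {X : Type} [MetricSpace X]

/-- The sum `∑ m(B(xᵢ,rᵢ))^q (2rᵢ)^t` associated with a countable family of centered balls. -/
def olsenSum [MeasurableSpace X] (m : Measure X) (q t : ℝ) {ι : Type}
    (c : ι → X) (r : ι → ℝ) : ℝ≥0∞ :=
  ∑' i, m (closedBall (c i) (r i)) ^ q * ENNReal.ofReal (2 * r i) ^ t

/-- `Olsen's 𝓗^{q,t}_{m,δ}`: infimum over countable centered `δ`-coverings of `E`. -/
def Hdel [MeasurableSpace X] (m : Measure X) (q t δ : ℝ) (E : Set X) : ℝ≥0∞ :=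
  ⨅ (ι : Type) (_ : Countable ι) (c : ι → X) (r : ι → ℝ)
    (_ : ∀ i, c i ∈ E) (_ : ∀ i, 0 < r i ∧ r i ≤ δ)
    (_ : E ⊆ ⋃ i, closedBall (c i) (r i)), olsenSum m q t c r

/-- Olsen's premeasure `𝓗̄^{q,t}_m` (limit, i.e. supremum, as `δ ↓ 0`). -/
def Hpre [MeasurableSpace X] (m : Measure X) (q t : ℝ) (E : Set X) : ℝ≥0∞ :=
  ⨆ (δ : ℝ) (_ : 0 < δ), Hdel m q t δ E

/-- Olsen's multifractal Hausdorff measure `𝓗^{q,t}_m`. -/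
def Hmeas [MeasurableSpace X] (m : Measure X) (q t : ℝ) (E : Set X) : ℝ≥0∞ :=
  ⨆ (F : Set X) (_ : F ⊆ E), Hpre m q t F

/-- `𝓟̄^{q,t}_{m,δ}`: supremum over countable centered `δ`-packings of `E`. -/
def Pdel [MeasurableSpace X] (m : Measure X) (q t δ : ℝ) (E : Set X) : ℝ≥0∞ :=
  ⨆ (ι : Type) (_ : Countable ι) (c : ι → X) (r : ι → ℝ)
    (_ : ∀ i, c i ∈ E) (_ : ∀ i, 0 < r i ∧ r i ≤ δ)
    (_ : ∀ i j, i ≠ j → Disjoint (closedBall (c i) (r i)) (closedBall (c j) (r j))),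
    olsenSum m q t c r

/-- Olsen's packing premeasure `𝓟̄^{q,t}_m` (limit, i.e. infimum, as `δ ↓ 0`). -/
def Ppre [MeasurableSpace X] (m : Measure X) (q t : ℝ) (E : Set X) : ℝ≥0∞ :=
  ⨅ (δ : ℝ) (_ : 0 < δ), Pdel m q t δ E

/-- Olsen's multifractal packing measure `𝓟^{q,t}_m`. -/
def Pmeas [MeasurableSpace X] (m : Measure X) (q t : ℝ) (E : Set X) : ℝ≥0∞ :=
  ⨅ (En : ℕ → Set X) (_ : E ⊆ ⋃ n, En n), ∑' n, Ppre m q t (En n)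

/-- The (topological) support of a measure on a metric space. -/
def msupport [MeasurableSpace X] (m : Measure X) : Set X :=
  {x | ∀ r : ℝ, 0 < r → 0 < m (ball x r)}

/-- Olsen's multifractal Hausdorff dimension function `b_m`. -/
def bFun [MeasurableSpace X] (m : Measure X) (q : ℝ) : ℝ :=
  sInf {t | Hmeas m q t (msupport m) = 0}

/-- Olsen's multifractal packing dimension function `B_m`. -/
def BFun [MeasurableSpace X] (m : Measure X) (q : ℝ) : ℝ :=
  sInf {t | Pmeas m q t (msupport m) = 0}

/-- Olsen's function `τ_m`. -/
def tauFun [MeasurableSpace X] (m : Measure X) (q : ℝ) : ℝ :=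
  sInf {t | Ppre m q t (msupport m) = 0}

/-- `t`-dimensional packing pre-premeasure at scale `δ`. -/
def pPdel (t δ : ℝ) (E : Set X) : ℝ≥0∞ :=
  ⨆ (ι : Type) (_ : Countable ι) (c : ι → X) (r : ι → ℝ)
    (_ : ∀ i, c i ∈ E) (_ : ∀ i, 0 < r i ∧ r i ≤ δ)
    (_ : ∀ i j, i ≠ j → Disjoint (closedBall (c i) (r i)) (closedBall (c j) (r j))),
    ∑' i, ENNReal.ofReal (2 * r i) ^ t

/-- `t`-dimensional packing premeasure. -/
def pPpre (t : ℝ) (E : Set X) : ℝ≥0∞ := ⨅ (δ : ℝ) (_ : 0 < δ), pPdel t δ E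

/-- `t`-dimensional packing measure. -/
def pPmeas (t : ℝ) (E : Set X) : ℝ≥0∞ :=
  ⨅ (En : ℕ → Set X) (_ : E ⊆ ⋃ n, En n), ∑' n, pPpre t (En n)

/-- Packing dimension of a set. -/
def packDim (E : Set X) : ℝ := sInf {t | pPmeas t E = 0}

/-- The level set `X_m(α)` of points of the support where the local Hölder exponent is `α`. -/
def Xlev [MeasurableSpace X] (m : Measure X) (α : ℝ) : Set X :=
  {x | x ∈ msupport m ∧
    Tendsto (fun r => Real.log (m (closedBall x r)).toReal / Real.log r)
      (𝓝[>] (0 : ℝ)) (𝓝 α)}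

/-- Legendre transform `f^*(x) = inf_y (xy + f(y))`. -/
def leg (f : ℝ → ℝ) (x : ℝ) : ℝ := ⨅ y : ℝ, (x * y + f y)

/-! ### The mixed symbolic space and inhomogeneous multinomial measures -/

/-- `j` is an index governed by the first alphabet:
`T (2k-1) ≤ j < T (2k)` for some `k ≥ 1`. -/
def isA (T : ℕ → ℕ) (j : ℕ) : Prop :=
  ∃ k, 1 ≤ k ∧ T (2 * k - 1) ≤ j ∧ j < T (2 * k)

/-- The size of the alphabet at (0-based) position `n`, i.e. at paper index `j = n+1`. -/
def Yc (c₁ c₂ : ℕ) (T : ℕ → ℕ) (n : ℕ) : ℕ := if isA T (n + 1) then c₁ else c₂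

/-- The mixed symbolic space `∂𝒜₁,₂* = ∏ⱼ Yⱼ`. -/
abbrev Omg (c₁ c₂ : ℕ) (T : ℕ → ℕ) : Type := ∀ n : ℕ, Fin (Yc c₁ c₂ T n)

/-- Finite words of length `n`. -/
abbrev Word (c₁ c₂ : ℕ) (T : ℕ → ℕ) (n : ℕ) : Type :=
  ∀ i : Fin n, Fin (Yc c₁ c₂ T i.val)

/-- `N_n`: the number of indices `1 ≤ j ≤ n` governed by the first alphabet. -/
def Ncount (T : ℕ → ℕ) (n : ℕ) : ℕ := ((Finset.Icc 1 n).filter (isA T)).card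

/-- Diameter `c₁^{-N_n} c₂^{-(n-N_n)}` of a cylinder of generation `n`. -/
def Dw (c₁ c₂ : ℕ) (T : ℕ → ℕ) (n : ℕ) : ℝ :=
  ((c₁ : ℝ) ^ Ncount T n * (c₂ : ℝ) ^ (n - Ncount T n))⁻¹

/-- The cylinder `[w]` defined by a finite word `w`. -/
def cyl (c₁ c₂ : ℕ) (T : ℕ → ℕ) (n : ℕ) (w : Word c₁ c₂ T n) : Set (Omg c₁ c₂ T) :=
  {x | ∀ i : Fin n, x i.val = w i}

/-- The mass `∏_{j≤n} p_j` given to the cylinder `[w]` by the inhomogeneous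
multinomial measure with weights `a` and `b`. -/
def cylWeight (c₁ c₂ : ℕ) (T : ℕ → ℕ) (a b : ℕ → ℝ) (n : ℕ) (w : Word c₁ c₂ T n) : ℝ :=
  ∏ i : Fin n, (if isA T (i.val + 1) then a (w i).val else b (w i).val)

/-- `θ(q) = log_c (p₁^q + ⋯ + p_c^q)`. -/
def theta (c : ℕ) (p : ℕ → ℝ) (q : ℝ) : ℝ :=
  Real.logb c (∑ i ∈ Finset.range c, p i ^ q)

/-- `τ_{μ,n}(q)`, defined by `∑_{z ∈ 𝒜₁,₂ⁿ} μ([z])^q = |w|^{-τ_{μ,n}(q)}`. -/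
def tauN (c₁ c₂ : ℕ) (T : ℕ → ℕ) (a b : ℕ → ℝ) (q : ℝ) (n : ℕ) : ℝ :=
  Real.log (∑ z : Word c₁ c₂ T n, cylWeight c₁ c₂ T a b n z ^ q) /
    Real.log ((c₁ : ℝ) ^ Ncount T n * (c₂ : ℝ) ^ (n - Ncount T n))

/-- The natural projection `γ : ∂𝒜₁,₂* → [0,1]`,
`γ(ε₁ε₂⋯) = ∑_{n≥1} εₙ c₁^{-N_n} c₂^{-(n-N_n)}`. -/
def gammaMap (c₁ c₂ : ℕ) (T : ℕ → ℕ) (x : Omg c₁ c₂ T) : ℝ :=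
  ∑' n : ℕ, ((x n).val : ℝ) * Dw c₁ c₂ T (n + 1)

/-- The normalized weights `pᵢ^q / (p₁^q + ⋯ + p_c^q)`. -/
def taW (c : ℕ) (p : ℕ → ℝ) (q : ℝ) (i : ℕ) : ℝ :=
  p i ^ q / ∑ j ∈ Finset.range c, p j ^ q

/-- `s₁ = min{max aᵢ, max bⱼ}`. -/
def sOne (c₁ c₂ : ℕ) (a b : ℕ → ℝ) : ℝ :=
  min (sSup {x | ∃ i < c₁, a i = x}) (sSup {x | ∃ j < c₂, b j = x})

/-- `s₂ = max{min aᵢ, min bⱼ}`. -/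
def sTwo (c₁ c₂ : ℕ) (a b : ℕ → ℝ) : ℝ :=
  max (sInf {x | ∃ i < c₁, a i = x}) (sInf {x | ∃ j < c₂, b j = x})

/-- Entropy `h(p) = -∑_{i<2} pᵢ log₂ pᵢ`. -/
def hEnt (p : ℕ → ℝ) : ℝ := -(∑ i ∈ Finset.range 2, p i * Real.logb 2 (p i))

/-! ### Dyadic intervals -/

/-- The family `𝓕_n` of dyadic intervals of generation `n` in `[0,1]`. -/
def Fnfam (n : ℕ) : Set (Set ℝ) :=
  {I | ∃ j : ℕ, j < 2 ^ n ∧ I = Set.Icc ((j : ℝ) / 2 ^ n) (((j : ℝ) + 1) / 2 ^ n)}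

/-- Index of the dyadic interval of generation `n` containing `x`
(the left one when `x` is dyadic). -/
def dyadIdx (n : ℕ) (x : ℝ) : ℤ := ⌈x * 2 ^ n⌉ - 1

/-- `I_n(x)`: the dyadic interval of generation `n` containing `x`
(the left one when `x` is dyadic). -/
def Idyad (n : ℕ) (x : ℝ) : Set ℝ :=
  Set.Icc ((dyadIdx n x : ℝ) / 2 ^ n) (((dyadIdx n x : ℝ) + 1) / 2 ^ n)

/-- `I_n(x)⁺`: the right neighbour of `I_n(x)` in `𝓕_n`. -/
def IdyadP (n : ℕ) (x : ℝ) : Set ℝ :=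
  Set.Icc (((dyadIdx n x : ℝ) + 1) / 2 ^ n) (((dyadIdx n x : ℝ) + 2) / 2 ^ n)

/-- `I_n(x)⁻`: the left neighbour of `I_n(x)` in `𝓕_n`. -/
def IdyadM (n : ℕ) (x : ℝ) : Set ℝ :=
  Set.Icc (((dyadIdx n x : ℝ) - 1) / 2 ^ n) ((dyadIdx n x : ℝ) / 2 ^ n)

/-! ### Comparing limits superior and inferior along a change of parameter -/

lemma limsup_le_limsup_of_le_comp_add {ι κ : Type*} {l : Filter ι} {l' : Filter κ} [NeBot l]
    {f e : ι → ℝ} {g : κ → ℝ} {φ : ι → κ} (hφ : Tendsto φ l l') (he : Tendsto e l (𝓝 0))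
    (hg : l'.IsBoundedUnder (· ≤ ·) g) (hf : l.IsBoundedUnder (· ≥ ·) f)
    (h : ∀ᶠ i in l, f i ≤ g (φ i) + e i) : limsup f l ≤ limsup g l' := by
  refine le_of_forall_pos_le_add fun ε hε => limsup_le_of_le hf.isCoboundedUnder_le ?_
  have h1 := hφ.eventually (eventually_lt_of_limsup_lt
    (show limsup g l' < limsup g l' + ε / 2 by linarith) hg)
  filter_upwards [h, h1, he.eventually_lt_const (half_pos hε)] with i h2 h3 h4
  linarith

lemma liminf_le_liminf_of_comp_sub_le {ι κ : Type*} {l : Filter ι} {l' : Filter κ} [NeBot l]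
    {f e : ι → ℝ} {g : κ → ℝ} {φ : ι → κ} (hφ : Tendsto φ l l') (he : Tendsto e l (𝓝 0))
    (hg : l'.IsBoundedUnder (· ≥ ·) g) (hf : l.IsBoundedUnder (· ≤ ·) f)
    (h : ∀ᶠ i in l, g (φ i) - e i ≤ f i) : liminf g l' ≤ liminf f l := by
  refine le_of_forall_pos_sub_le fun ε hε => le_liminf_of_le hf.isCoboundedUnder_ge ?_
  have h1 := hφ.eventually (eventually_lt_of_lt_liminf
    (show liminf g l' - ε / 2 < liminf g l' by linarith) hg)
  filter_upwards [h, h1, he.eventually_lt_const (half_pos hε)] with i h2 h3 h4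
  linarith

lemma tendsto_natSqrt_div : Tendsto (fun n : ℕ => (Nat.sqrt n : ℝ) / n) atTop (𝓝 0) := by
  have h : Tendsto (fun n : ℕ => (√(n : ℝ))⁻¹) atTop (𝓝 0) :=
    tendsto_inv_atTop_zero.comp (Real.tendsto_sqrt_atTop.comp tendsto_natCast_atTop_atTop)
  refine squeeze_zero (fun n => by positivity) (fun n => ?_) h
  calc (Nat.sqrt n : ℝ) / n ≤ √(n : ℝ) / n := by gcongr; exact Real.nat_sqrt_le_real_sqrt
    _ = (√(n : ℝ))⁻¹ := Real.sqrt_div_self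

lemma tendsto_sub_natSqrt : Tendsto (fun n : ℕ => n - Nat.sqrt n) atTop atTop := by
  refine tendsto_atTop.2 fun b => ?_
  filter_upwards [eventually_ge_atTop (2 * b + 4)] with n hn
  have h1 := Nat.sqrt_le n
  have h2 : Nat.sqrt n * 2 ≤ n := by
    rcases Nat.lt_or_ge (Nat.sqrt n) 2 with h | h
    · omega
    · nlinarith
  omega

/-- Along `r → 0⁺`, the exponents of `g` at scale `r` have the same lower and upper limits as the
exponents of `u` at dyadic scales, once `g` and `u` are comparable up to a subexponential change
of scale. -/
lemma liminf_limsup_scale_eq {g : ℝ → ℝ} {u : ℕ → ℝ} {m : ℝ} (hm : 0 < m)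
    (hg : ∀ r, g r ≤ 1) (hu : ∀ᶠ n in atTop, m ^ n ≤ u n)
    (hug : ∀ᶠ n in atTop, ∀ r, (1 / 2 : ℝ) ^ n ≤ r → u n ≤ g r)
    (hgu : ∀ᶠ n : ℕ in atTop, ∀ r, 0 < r → r ≤ (1 / 2 : ℝ) ^ (n + Nat.sqrt n) → g r ≤ u n)
    (hu1 : ∀ n, u n ≤ 1) :
    liminf (fun r => Real.log (g r) / Real.log r) (𝓝[>] (0 : ℝ)) =
        liminf (fun n : ℕ => Real.log (u n) / (-((n : ℝ) * Real.log 2))) atTop ∧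
      limsup (fun r => Real.log (g r) / Real.log r) (𝓝[>] (0 : ℝ)) =
        limsup (fun n : ℕ => Real.log (u n) / (-((n : ℝ) * Real.log 2))) atTop := by
  set F : ℝ → ℝ := fun r => Real.log (g r) / Real.log r with hF
  set U : ℕ → ℝ := fun n => Real.log (u n) / (-((n : ℝ) * Real.log 2)) with hU
  have hl2 : 0 < Real.log 2 := Real.log_pos one_lt_two
  set C : ℝ := -Real.log m / Real.log 2 with hC
  have hv : ∀ n : ℕ, 1 ≤ n → -Real.log (u n) = U n * (n * Real.log 2) := by
    intro n hn
    have : (0 : ℝ) < n := by exact_mod_cast hn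
    simp only [hU]
    field_simp
  have hUb : ∀ᶠ n in atTop, 1 ≤ n ∧ 0 < u n ∧ 0 ≤ U n ∧ U n ≤ C := by
    filter_upwards [hu, eventually_ge_atTop 1] with n hn h1
    have hn0 : (0 : ℝ) < n := by exact_mod_cast h1
    have hun : 0 < u n := (pow_pos hm n).trans_le hn
    have h2 : n * Real.log m ≤ Real.log (u n) := by
      rw [← Real.log_pow]; exact Real.log_le_log (pow_pos hm n) hn
    have h3 := Real.log_nonpos hun.le (hu1 n)
    refine ⟨h1, hun, ?_, ?_⟩
    · exact div_nonneg_of_nonpos h3 (by nlinarith)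
    · simp only [hU, hC]
      rw [div_neg, ← neg_div, div_le_div_iff₀ (by positivity) hl2]
      nlinarith
  have hC0 : 0 ≤ C := by
    obtain ⟨n, hn⟩ := hUb.exists
    exact hn.2.2.1.trans hn.2.2.2
  set L : ℝ → ℕ := fun r => ⌊-Real.log r / Real.log 2⌋₊ with hL
  have hLt : Tendsto L (𝓝[>] (0 : ℝ)) atTop :=
    tendsto_nat_floor_atTop.comp
      ((tendsto_neg_atBot_atTop.comp Real.tendsto_log_nhdsGT_zero).atTop_div_const hl2)
  have hLr : ∀ᶠ r in 𝓝[>] (0 : ℝ), 0 < r ∧ L r * Real.log 2 ≤ -Real.log r ∧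
      -Real.log r < (L r + 1) * Real.log 2 := by
    filter_upwards [self_mem_nhdsWithin, (eventually_lt_nhds one_pos).filter_mono
      nhdsWithin_le_nhds] with r hr hr1
    have hlog : 0 ≤ -Real.log r / Real.log 2 :=
      div_nonneg (neg_nonneg.2 (Real.log_nonpos (le_of_lt hr) hr1.le)) hl2.le
    exact ⟨hr, (le_div_iff₀ hl2).1 (Nat.floor_le hlog),
      (div_lt_iff₀ hl2).1 (Nat.lt_floor_add_one _)⟩
  have hpowle : ∀ (n : ℕ) (r : ℝ), 0 < r → ((1 / 2 : ℝ) ^ n ≤ r ↔ -Real.log r ≤ n * Real.log 2) := by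
    intro n r hr
    rw [← Real.log_le_log_iff (by positivity) hr, Real.log_pow, one_div, Real.log_inv]
    constructor <;> intro h <;> linarith
  have hlepow : ∀ (n : ℕ) (r : ℝ), 0 < r → (r ≤ (1 / 2 : ℝ) ^ n ↔ n * Real.log 2 ≤ -Real.log r) := by
    intro n r hr
    rw [← Real.log_le_log_iff hr (by positivity), Real.log_pow, one_div, Real.log_inv]
    constructor <;> intro h <;> linarith
  have hφ1 : Tendsto (fun r => L r + 1) (𝓝[>] (0 : ℝ)) atTop :=
    (tendsto_add_atTop_nat 1).comp hLt
  have hφ2 : Tendsto (fun r => L r - Nat.sqrt (L r)) (𝓝[>] (0 : ℝ)) atTop :=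
    tendsto_sub_natSqrt.comp hLt
  have hpow0 : Tendsto (fun n : ℕ => (1 / 2 : ℝ) ^ n) atTop (𝓝[>] 0) :=
    tendsto_nhdsWithin_iff.2 ⟨tendsto_pow_atTop_nhds_zero_of_lt_one (by norm_num) (by norm_num),
      Eventually.of_forall fun n => by simp only [mem_Ioi]; positivity⟩
  have hψ : Tendsto (fun n : ℕ => (1 / 2 : ℝ) ^ (n + Nat.sqrt n)) atTop (𝓝[>] 0) :=
    hpow0.comp (tendsto_atTop_mono (fun n => Nat.le_add_right _ _) tendsto_id)
  have hinv : Tendsto (fun n : ℕ => C * (1 / (n : ℝ))) atTop (𝓝 0) := by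
    simpa using tendsto_one_div_atTop_nhds_zero_nat.const_mul C
  have hsq : Tendsto (fun n : ℕ => C * ((Nat.sqrt n : ℝ) / n)) atTop (𝓝 0) := by
    simpa using tendsto_natSqrt_div.const_mul C
  -- comparison of `F` with `U` from above
  have hup : ∀ᶠ r in 𝓝[>] (0 : ℝ), 0 ≤ F r ∧ F r ≤ U (L r + 1) + C * (1 / (L r : ℝ)) := by
    filter_upwards [hLr, hφ1.eventually hUb, hφ1.eventually hug, hLt.eventually_ge_atTop 1]
      with r ⟨hr, hL1, hL2⟩ ⟨hn1, hu0, hU0, hUC⟩ hug hL0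
    have hLpos : (0 : ℝ) < L r := by exact_mod_cast hL0
    have h1 : u (L r + 1) ≤ g r := hug r ((hpowle _ r hr).2 (by push_cast; exact hL2.le))
    have h2 := Real.log_le_log hu0 h1
    have h3 := hv _ hn1
    have h4 : 0 < -Real.log r := lt_of_lt_of_le (by positivity) hL1
    have h5 := Real.log_nonpos (hu0.le.trans h1) (hg r)
    push_cast at h3
    refine ⟨div_nonneg_of_nonpos h5 (by linarith), ?_⟩
    have h6 : F r = -Real.log (g r) / -Real.log r := (neg_div_neg_eq _ _).symm
    rw [h6]
    calc -Real.log (g r) / -Real.log r ≤ (U (L r + 1) * ((L r + 1) * Real.log 2)) / -Real.log r := by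
          gcongr; linarith
      _ ≤ (U (L r + 1) * ((L r + 1) * Real.log 2)) / (L r * Real.log 2) := by gcongr
      _ = U (L r + 1) + U (L r + 1) * (1 / (L r : ℝ)) := by field_simp
      _ ≤ _ := by gcongr
  have hFge : (𝓝[>] (0 : ℝ)).IsBoundedUnder (· ≥ ·) F :=
    ⟨0, eventually_map.2 (hup.mono fun r h => h.1)⟩
  have hFle : (𝓝[>] (0 : ℝ)).IsBoundedUnder (· ≤ ·) F := by
    refine ⟨C + 1, eventually_map.2 ?_⟩
    filter_upwards [hup, hφ1.eventually hUb,
      (hinv.comp hLt).eventually_lt_const one_pos] with r h1 h2 h3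
    simp only [Function.comp_apply] at h3
    linarith [h1.2, h2.2.2.2]
  have hUge : atTop.IsBoundedUnder (· ≥ ·) U := ⟨0, eventually_map.2 (hUb.mono fun r h => h.2.2.1)⟩
  have hUle : atTop.IsBoundedUnder (· ≤ ·) U := ⟨C, eventually_map.2 (hUb.mono fun r h => h.2.2.2)⟩
  -- comparison of `F` with `U` from below
  have hlow : ∀ᶠ r in 𝓝[>] (0 : ℝ), U (L r - Nat.sqrt (L r)) -
      (C * ((Nat.sqrt (L r) : ℝ) / L r) + C * (1 / (L r : ℝ))) ≤ F r := by
    filter_upwards [hLr, hφ2.eventually hUb, hφ2.eventually hgu, hLt.eventually_ge_atTop 1,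
      hφ1.eventually hug, hφ1.eventually hUb]
      with r ⟨hr, hL1, hL2⟩ ⟨hn1, hu0, hU0, hUC⟩ hgu hL0 hug hU'
    have hLpos : (0 : ℝ) < L r := by exact_mod_cast hL0
    have hg0 : 0 < g r := hU'.2.1.trans_le (hug r ((hpowle _ r hr).2 (by push_cast; exact hL2.le)))
    have hcast : ((L r - Nat.sqrt (L r) : ℕ) : ℝ) = L r - Nat.sqrt (L r) :=
      Nat.cast_sub (Nat.sqrt_le_self _)
    have hle : (L r - Nat.sqrt (L r)) + Nat.sqrt (L r - Nat.sqrt (L r)) ≤ L r := by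
      have := Nat.sqrt_le_sqrt (Nat.sub_le (L r) (Nat.sqrt (L r)))
      have := Nat.sqrt_le_self (L r)
      omega
    have h1 : g r ≤ u (L r - Nat.sqrt (L r)) := by
      refine hgu r hr ((hlepow _ r hr).2 (le_trans ?_ hL1))
      gcongr
    have h2 := Real.log_le_log hg0 h1
    have h3 := hv _ hn1
    have h4 : 0 < -Real.log r := lt_of_lt_of_le (by positivity) hL1
    have h6 : F r = -Real.log (g r) / -Real.log r := (neg_div_neg_eq _ _).symm
    rw [hcast] at h3
    set V := U (L r - Nat.sqrt (L r))
    set s : ℝ := (Nat.sqrt (L r) : ℝ)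
    set l : ℝ := (L r : ℝ)
    have hs : 0 ≤ s := Nat.cast_nonneg _
    have hsl : s ≤ l := by simp only [s, l]; exact_mod_cast Nat.sqrt_le_self _
    rw [h6]
    calc V - (C * (s / l) + C * (1 / l)) = V - C * ((s + 1) / l) := by ring
      _ ≤ V - V * ((s + 1) / (l + 1)) := by gcongr; linarith
      _ = V * ((l - s) * Real.log 2) / ((l + 1) * Real.log 2) := by field_simp; ring
      _ ≤ V * ((l - s) * Real.log 2) / -Real.log r := by
          have : 0 ≤ l - s := by linarith
          gcongr
      _ ≤ _ := by gcongr; linarith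
  have hUF : ∀ᶠ n in atTop, F ((1 / 2 : ℝ) ^ n) - 0 ≤ U n := by
    filter_upwards [hUb, hug] with n ⟨h1, h2, h3, h4⟩ h5
    have hn0 : (0 : ℝ) < n := by exact_mod_cast h1
    have h6 := Real.log_le_log h2 (h5 _ le_rfl)
    have h7 : Real.log ((1 / 2 : ℝ) ^ n) = -(n * Real.log 2) := by
      rw [Real.log_pow, one_div, Real.log_inv]; ring
    simp only [hF, hU]
    rw [h7, sub_zero]
    exact div_le_div_of_nonpos_of_le (neg_nonpos.2 (by positivity)) h6
  have hFU : ∀ᶠ n in atTop, U n ≤ F ((1 / 2 : ℝ) ^ (n + Nat.sqrt n)) +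
      C * ((Nat.sqrt n : ℝ) / n) := by
    have hshift : Tendsto (fun n => n + Nat.sqrt n) atTop atTop :=
      tendsto_atTop_mono (fun n => Nat.le_add_right _ _) tendsto_id
    filter_upwards [hUb, hgu, hshift.eventually hug, hshift.eventually hUb]
      with n ⟨h1, h2, h3, h4⟩ h5 h8 h9
    have hn0 : (0 : ℝ) < n := by exact_mod_cast h1
    have hg0 : 0 < g ((1 / 2 : ℝ) ^ (n + Nat.sqrt n)) := h9.2.1.trans_le (h8 _ le_rfl)
    have h6 := Real.log_le_log hg0 (h5 _ (by positivity) le_rfl)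
    have h7 : Real.log ((1 / 2 : ℝ) ^ (n + Nat.sqrt n)) = -((n + Nat.sqrt n) * Real.log 2) := by
      rw [Real.log_pow, one_div, Real.log_inv]; push_cast; ring
    have h10 := hv n h1
    set s : ℝ := (Nat.sqrt n : ℝ)
    have hs : 0 ≤ s := Nat.cast_nonneg _
    have h11 : U n - C * (s / n) ≤ F ((1 / 2 : ℝ) ^ (n + Nat.sqrt n)) := by
      calc U n - C * (s / n) ≤ U n - U n * (s / (n + s)) := by gcongr; linarith
        _ = U n * (n * Real.log 2) / ((n + s) * Real.log 2) := by field_simp; ring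
        _ ≤ -Real.log (g ((1 / 2 : ℝ) ^ (n + Nat.sqrt n))) / ((n + s) * Real.log 2) := by
            gcongr; linarith
        _ = F ((1 / 2 : ℝ) ^ (n + Nat.sqrt n)) := by
            simp only [hF]; rw [h7, div_neg, neg_div]
    linarith
  refine ⟨le_antisymm ?_ ?_, le_antisymm ?_ ?_⟩
  · exact liminf_le_liminf_of_comp_sub_le hpow0 tendsto_const_nhds hFge hUle hUF
  · exact liminf_le_liminf_of_comp_sub_le hφ2
      (by simpa using (hsq.comp hLt).add (hinv.comp hLt)) hUge hFle hlow
  · exact limsup_le_limsup_of_le_comp_add hφ1 (hinv.comp hLt) hUle hFge (hup.mono fun r h => h.2)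
  · exact limsup_le_limsup_of_le_comp_add hψ hsq hFle hUge hFU

/-! ### Binary expansions and dyadic intervals -/

lemma exists_int_sum_ofDigitsTerm (d : ℕ → Fin 2) (n : ℕ) :
    ∃ z : ℤ, ∑ i ∈ Finset.range n, Real.ofDigitsTerm d i = z / 2 ^ n := by
  induction n with
  | zero => exact ⟨0, by simp⟩
  | succ n ih =>
    obtain ⟨z, hz⟩ := ih
    refine ⟨2 * z + (d n).val, ?_⟩
    rw [Finset.sum_range_succ, hz, Real.ofDigitsTerm]
    push_cast
    field_simp
    ring

lemma ofDigits_le_of_digit_eq_zero {d : ℕ → Fin 2} {i k : ℕ} (hi : i < k) (h : d i = 0) :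
    Real.ofDigits d ≤ 1 - (1 / 2) ^ k := by
  have h1 : Real.ofDigits d + Real.ofDigits (fun j => Fin.rev (d j)) = 1 := by
    rw [← Real.ofDigits_const_last_eq_one' (b := 2) one_lt_two, Real.ofDigits, Real.ofDigits,
      Real.ofDigits, ← Real.summable_ofDigitsTerm.tsum_add Real.summable_ofDigitsTerm]
    refine tsum_congr fun j => ?_
    simp only [Real.ofDigitsTerm, ← add_mul]
    congr 1
    generalize d j = x
    fin_cases x <;> simp
  have h2 : Real.ofDigitsTerm (fun j => Fin.rev (d j)) i ≤ Real.ofDigits (fun j => Fin.rev (d j)) :=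
    Real.summable_ofDigitsTerm.le_tsum i fun _ _ => Real.ofDigitsTerm_nonneg
  have h3 : Real.ofDigitsTerm (fun j => Fin.rev (d j)) i = (1 / 2) ^ (i + 1) := by
    simp [Real.ofDigitsTerm, h]
  have h4 : (1 / 2 : ℝ) ^ k ≤ (1 / 2) ^ (i + 1) :=
    pow_le_pow_of_le_one (by norm_num) (by norm_num) hi
  linarith

lemma le_ofDigits_of_digit_eq_one {d : ℕ → Fin 2} {i k : ℕ} (hi : i < k) (h : d i = 1) :
    (1 / 2) ^ k ≤ Real.ofDigits d := by
  have h2 : Real.ofDigitsTerm d i ≤ Real.ofDigits d :=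
    Real.summable_ofDigitsTerm.le_tsum i fun _ _ => Real.ofDigitsTerm_nonneg
  have h3 : Real.ofDigitsTerm d i = (1 / 2) ^ (i + 1) := by
    simp [Real.ofDigitsTerm, h]
  have h4 : (1 / 2 : ℝ) ^ k ≤ (1 / 2) ^ (i + 1) :=
    pow_le_pow_of_le_one (by norm_num) (by norm_num) hi
  linarith

lemma dyadIdx_eq_of_mem_Ioc {n : ℕ} {x : ℝ} {z : ℤ} (h1 : (z : ℝ) / 2 ^ n < x)
    (h2 : x ≤ ((z : ℝ) + 1) / 2 ^ n) : dyadIdx n x = z := by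
  have h0 : (0 : ℝ) < 2 ^ n := by positivity
  rw [div_lt_iff₀ h0] at h1
  rw [le_div_iff₀ h0] at h2
  rw [dyadIdx, sub_eq_iff_eq_add, Int.ceil_eq_iff]
  push_cast
  exact ⟨by linarith, h2⟩

/-- Points at distance at least `2^{-(n+k)}` from the complement of their dyadic interval of
generation `n`. -/
def deepSet (n k : ℕ) : Set ℝ :=
  {x | (dyadIdx n x : ℝ) / 2 ^ n + (1 / 2) ^ (n + k) ≤ x ∧
    x ≤ ((dyadIdx n x : ℝ) + 1) / 2 ^ n - (1 / 2) ^ (n + k)}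

lemma measurableSet_deepSet (n k : ℕ) : MeasurableSet (deepSet n k) := by
  have h : Measurable fun x : ℝ => (dyadIdx n x : ℝ) := by
    unfold dyadIdx
    fun_prop
  exact (measurableSet_le (by fun_prop) measurable_id).inter
    (measurableSet_le measurable_id (by fun_prop))

lemma closedBall_subset_Idyad {n k : ℕ} {x r : ℝ} (hx : x ∈ deepSet n k)
    (hr : r ≤ (1 / 2) ^ (n + k)) : closedBall x r ⊆ Idyad n x := by
  rw [Real.closedBall_eq_Icc]
  exact Icc_subset_Icc (by linarith [hx.1]) (by linarith [hx.2])

lemma Idyad_subset_closedBall {n k : ℕ} {x r : ℝ} (hx : x ∈ deepSet n k)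
    (hr : (1 / 2) ^ n ≤ r) : Idyad n x ⊆ closedBall x r := by
  have h0 : (0 : ℝ) < (1 / 2) ^ (n + k) := by positivity
  have h1 : ((dyadIdx n x : ℝ) + 1) / 2 ^ n = (dyadIdx n x : ℝ) / 2 ^ n + (1 / 2) ^ n := by
    rw [add_div, one_div_pow]
  rw [Real.closedBall_eq_Icc]
  exact Icc_subset_Icc (by linarith [hx.2]) (by linarith [hx.1])

lemma ofDigits_split (d : ℕ → Fin 2) (n : ℕ) : ∃ z : ℤ,
    ∑ i ∈ Finset.range n, Real.ofDigitsTerm d i = z / 2 ^ n ∧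
    Real.ofDigits d = z / 2 ^ n + (1 / 2) ^ n * Real.ofDigits fun i => d (i + n) := by
  obtain ⟨z, hz⟩ := exists_int_sum_ofDigitsTerm d n
  refine ⟨z, hz, ?_⟩
  rw [Real.ofDigits_eq_sum_add_ofDigits d n, hz]
  simp

lemma ofDigits_mem_deepSet {d : ℕ → Fin 2} {n k : ℕ} (h0 : ∃ i < k, d (i + n) = 0)
    (h1 : ∃ i < k, d (i + n) = 1) : Real.ofDigits d ∈ deepSet n k := by
  obtain ⟨z, -, hz⟩ := ofDigits_split d n
  obtain ⟨i, hi, hdi⟩ := h0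
  obtain ⟨j, hj, hdj⟩ := h1
  have h2 := ofDigits_le_of_digit_eq_zero (d := fun i => d (i + n)) hi hdi
  have h3 := le_ofDigits_of_digit_eq_one (d := fun i => d (i + n)) hj hdj
  have hn : (0 : ℝ) < (1 / 2) ^ n := by positivity
  have hk : (0 : ℝ) < (1 / 2) ^ k := by positivity
  have h5 : ((z : ℝ) + 1) / 2 ^ n = z / 2 ^ n + (1 / 2) ^ n := by rw [add_div, one_div_pow]
  have hidx : dyadIdx n (Real.ofDigits d) = z :=
    dyadIdx_eq_of_mem_Ioc (by nlinarith) (by nlinarith)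
  rw [deepSet, mem_ofPred_eq, hidx, h5, hz, pow_add]
  constructor <;> nlinarith

/-- A point lying deep in its dyadic interval of generation `n` has a binary expansion whose
first `n` digits determine a cylinder contained in that interval. -/
lemma exists_digits_cylinder_subset_Idyad {n k : ℕ} {x : ℝ} (hx : x ∈ deepSet n k)
    (hx01 : x ∈ Icc (0 : ℝ) 1) : ∃ d : ℕ → Fin 2, ∀ d' : ℕ → Fin 2, (∀ i < n, d' i = d i) →
      Real.ofDigits d' ∈ Idyad n x := by
  obtain ⟨d, -, rfl⟩ := Real.ofDigits_SurjOn one_lt_two hx01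
  refine ⟨d, fun d' hd' => ?_⟩
  obtain ⟨z, hzs, hz⟩ := ofDigits_split d n
  obtain ⟨z', hzs', hz'⟩ := ofDigits_split d' n
  have hsum : ∑ i ∈ Finset.range n, Real.ofDigitsTerm d' i =
      ∑ i ∈ Finset.range n, Real.ofDigitsTerm d i :=
    Finset.sum_congr rfl fun i hi => by
      simp [Real.ofDigitsTerm, hd' i (Finset.mem_range.1 hi)]
  rw [← hzs', hsum, hzs] at hz'
  have hn : (0 : ℝ) < (1 / 2) ^ n := by positivity
  have hnk : (0 : ℝ) < (1 / 2) ^ (n + k) := by positivity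
  have h5 : ∀ y : ℝ, (y + 1) / 2 ^ n = y / 2 ^ n + (1 / 2) ^ n := fun y => by
    rw [add_div, one_div_pow]
  have ht0 := Real.ofDigits_nonneg fun i => d (i + n)
  have ht1 := Real.ofDigits_le_one fun i => d (i + n)
  have hidx : dyadIdx n (Real.ofDigits d) = z := by
    refine dyadIdx_eq_of_mem_Ioc ?_ ?_
    · rcases ht0.eq_or_lt with h | h
      · exfalso
        rw [← h, mul_zero, add_zero] at hz
        have hx2 := hx.2
        have : dyadIdx n (Real.ofDigits d) = z - 1 := by
          rw [dyadIdx, hz, div_mul_cancel₀ _ (by positivity), Int.ceil_intCast]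
        rw [this, hz] at hx2
        push_cast at hx2
        rw [sub_add_cancel] at hx2
        linarith
      · rw [hz]
        have := mul_pos hn h
        linarith
    · rw [h5, hz]
      nlinarith
  have hs0 := Real.ofDigits_nonneg fun i => d' (i + n)
  have hs1 := Real.ofDigits_le_one fun i => d' (i + n)
  rw [Idyad, hidx, hz', h5]
  constructor
  · have := mul_nonneg hn.le hs0
    linarith
  · nlinarith

/-! ### The coding map and estimates for inhomogeneous multinomial measures -/

lemma Yc_two (T : ℕ → ℕ) (n : ℕ) : Yc 2 2 T n = 2 := by
  unfold Yc
  split_ifs <;> rfl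

/-- The sequence of binary digits of a point of the mixed symbolic space. -/
def binDigits (T : ℕ → ℕ) (x : Omg 2 2 T) : ℕ → Fin 2 := fun n => Fin.cast (Yc_two T n) (x n)

/-- The point of the mixed symbolic space with given binary digits. -/
def ofBinDigits (T : ℕ → ℕ) (d : ℕ → Fin 2) : Omg 2 2 T :=
  fun n => Fin.cast (Yc_two T n).symm (d n)

lemma Dw_two (T : ℕ → ℕ) (n : ℕ) : Dw 2 2 T n = ((2 : ℝ) ^ n)⁻¹ := by
  have h : Ncount T n ≤ n := by
    simpa [Ncount] using Finset.card_filter_le (Finset.Icc 1 n) (isA T)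
  rw [Dw]
  push_cast
  rw [← pow_add, Nat.add_sub_cancel' h]

lemma gammaMap_eq_ofDigits (T : ℕ → ℕ) (x : Omg 2 2 T) :
    gammaMap 2 2 T x = Real.ofDigits (binDigits T x) := by
  simp [gammaMap, Real.ofDigits, Real.ofDigitsTerm, Dw_two, binDigits]

lemma measurable_gammaMap (T : ℕ → ℕ) : Measurable (gammaMap 2 2 T) := by
  rw [show gammaMap 2 2 T = Real.ofDigits ∘ binDigits T from funext (gammaMap_eq_ofDigits T)]
  refine Real.continuous_ofDigits.measurable.comp (measurable_pi_lambda _ fun n => ?_)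
  exact (measurable_from_top (f := Fin.cast (Yc_two T n))).comp (measurable_pi_apply n)

lemma measurableSet_cyl (T : ℕ → ℕ) (n : ℕ) (w : Word 2 2 T n) :
    MeasurableSet (cyl 2 2 T n w) := by
  rw [cyl, ofPred_forall]
  exact MeasurableSet.iInter fun i => (measurableSet_singleton (w i)).preimage
    (measurable_pi_apply i.val)

lemma pow_le_cylWeight {T : ℕ → ℕ} {a b : ℕ → ℝ} {m : ℝ} (hm : 0 ≤ m)
    (ha : ∀ i < 2, m ≤ a i) (hb : ∀ i < 2, m ≤ b i) (n : ℕ) (w : Word 2 2 T n) :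
    m ^ n ≤ cylWeight 2 2 T a b n w := by
  rw [cylWeight, ← Fin.prod_const]
  refine Finset.prod_le_prod (fun _ _ => hm) fun i _ => ?_
  have hw : (w i).val < 2 := (w i).isLt.trans_eq (Yc_two T i)
  split_ifs
  exacts [ha _ hw, hb _ hw]

/-- A run of `k` prescribed digits has mass at most `M ^ k` when all weights are at most `M`. -/
lemma measure_run_le {T : ℕ → ℕ} {a b : ℕ → ℝ} {M : ℝ} {μ : Measure (Omg 2 2 T)}
    [IsProbabilityMeasure μ]
    (ha : ∀ i < 2, 0 ≤ a i ∧ a i ≤ M) (hb : ∀ i < 2, 0 ≤ b i ∧ b i ≤ M)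
    (hμ : ∀ (n : ℕ) (w : Word 2 2 T n),
      μ (cyl 2 2 T n w) = ENNReal.ofReal (cylWeight 2 2 T a b n w))
    (n k : ℕ) (c : Omg 2 2 T) :
    μ {x | ∀ i < k, x (i + n) = c (i + n)} ≤ ENNReal.ofReal (M ^ k) := by
  set ext : Word 2 2 T n → Word 2 2 T (n + k) := fun w i =>
    if h : i.val < n then w ⟨i.val, h⟩ else c i.val with hext
  have hsub : {x | ∀ i < k, x (i + n) = c (i + n)} ⊆ ⋃ w, cyl 2 2 T (n + k) (ext w) := by
    intro x hx
    refine mem_iUnion.2 ⟨fun i => x i.val, fun i => ?_⟩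
    simp only [hext]
    split_ifs with h
    · rfl
    · have h2 := i.isLt
      have h3 := hx (i.val - n) (by omega)
      rwa [Nat.sub_add_cancel (by omega)] at h3
  have hterm : ∀ (j : ℕ) (y : Fin (Yc 2 2 T j)),
      0 ≤ (if isA T (j + 1) then a y.val else b y.val) ∧
        (if isA T (j + 1) then a y.val else b y.val) ≤ M := by
    intro j y
    have hy : y.val < 2 := y.isLt.trans_eq (Yc_two T j)
    split_ifs
    exacts [ha _ hy, hb _ hy]
  have hw0 : ∀ w, 0 ≤ cylWeight 2 2 T a b n w := fun w =>
    Finset.prod_nonneg fun i _ => (hterm i.val (w i)).1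
  have hweight : ∀ w, cylWeight 2 2 T a b (n + k) (ext w) ≤ cylWeight 2 2 T a b n w * M ^ k := by
    intro w
    rw [cylWeight, Fin.prod_univ_add, ← Fin.prod_const k M]
    refine mul_le_mul (le_of_eq ?_) ?_ ?_ (hw0 w)
    · rw [cylWeight]
      refine Finset.prod_congr rfl fun i _ => ?_
      simp [hext]
    · exact Finset.prod_le_prod (fun i _ => (hterm _ _).1) fun i _ => (hterm _ _).2
    · exact Finset.prod_nonneg fun i _ => (hterm _ _).1
  calc μ {x | ∀ i < k, x (i + n) = c (i + n)}
      ≤ ∑' w, μ (cyl 2 2 T (n + k) (ext w)) := (measure_mono hsub).trans (measure_iUnion_le _)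
    _ ≤ ∑' w, μ (cyl 2 2 T n w) * ENNReal.ofReal (M ^ k) := by
        refine ENNReal.tsum_le_tsum fun w => ?_
        rw [hμ, hμ, ← ENNReal.ofReal_mul (hw0 w)]
        exact ENNReal.ofReal_le_ofReal (hweight w)
    _ = (∑' w, μ (cyl 2 2 T n w)) * ENNReal.ofReal (M ^ k) := ENNReal.tsum_mul_right
    _ ≤ 1 * ENNReal.ofReal (M ^ k) := by
        gcongr
        refine (tsum_meas_le_meas_iUnion_of_disjoint μ (measurableSet_cyl T n) ?_).trans prob_le_one
        intro w w' hne
        refine disjoint_left.2 fun x hx hx' => hne (funext fun i => ?_)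
        exact (hx i).symm.trans (hx' i)
    _ = ENNReal.ofReal (M ^ k) := one_mul _

lemma summable_pow_natSqrt {M : ℝ} (h0 : 0 ≤ M) (h1 : M < 1) :
    Summable fun n : ℕ => M ^ Nat.sqrt n := by
  obtain ⟨K, hK⟩ := (((tendsto_pow_const_mul_const_pow_of_lt_one 4 h0 h1).comp
    (tendsto_add_atTop_nat 1)).bddAbove_range)
  have hK' : ∀ s : ℕ, ((s + 1 : ℕ) : ℝ) ^ 4 * M ^ (s + 1) ≤ K := fun s => hK ⟨s, rfl⟩
  rcases h0.eq_or_lt with rfl | hM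
  · refine summable_of_ne_finset_zero (s := {0}) fun n hn => zero_pow ?_
    rw [Finset.mem_singleton] at hn
    exact (Nat.sqrt_pos.2 (Nat.pos_of_ne_zero hn)).ne'
  have hsum : Summable fun n : ℕ => K / M * (1 / (n : ℝ) ^ 2) :=
    (Real.summable_one_div_nat_pow.2 one_lt_two).mul_left _
  refine Summable.of_nonneg_of_le (fun n => by positivity) (fun n => ?_)
    ((summable_nat_add_iff 1).2 hsum |>.mul_left 4)
  have h2 : ((n + 1 : ℕ) : ℝ) ≤ ((Nat.sqrt n + 1 : ℕ) : ℝ) ^ 2 := by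
    have := Nat.lt_succ_sqrt n
    have h : n + 1 ≤ (Nat.sqrt n + 1) ^ 2 := by rw [pow_two]; exact this
    exact_mod_cast h
  have h3 := hK' (Nat.sqrt n)
  have h4 : ((n + 1 : ℕ) : ℝ) ^ 2 ≤ ((Nat.sqrt n + 1 : ℕ) : ℝ) ^ 4 := by
    calc ((n + 1 : ℕ) : ℝ) ^ 2 ≤ (((Nat.sqrt n + 1 : ℕ) : ℝ) ^ 2) ^ 2 := by gcongr
      _ = _ := by ring
  have h5 : (0 : ℝ) < ((n + 1 : ℕ) : ℝ) ^ 2 := by positivity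
  have h6 : M ^ Nat.sqrt n ≤ K / M * (1 / ((n + 1 : ℕ) : ℝ) ^ 2) := by
    rw [div_mul_div_comm, mul_one, le_div_iff₀ (by positivity)]
    calc M ^ Nat.sqrt n * (M * ((n + 1 : ℕ) : ℝ) ^ 2)
        = ((n + 1 : ℕ) : ℝ) ^ 2 * M ^ (Nat.sqrt n + 1) := by ring
      _ ≤ ((Nat.sqrt n + 1 : ℕ) : ℝ) ^ 4 * M ^ (Nat.sqrt n + 1) := by gcongr
      _ ≤ K := h3
  have h7 : (0 : ℝ) ≤ M ^ Nat.sqrt n := by positivity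
  linarith

lemma ae_eventually_mem_deepSet {T : ℕ → ℕ} {a b : ℕ → ℝ} {M : ℝ} {μ : Measure (Omg 2 2 T)}
    [IsProbabilityMeasure μ] (hM : 0 ≤ M) (hM1 : M < 1)
    (ha : ∀ i < 2, 0 ≤ a i ∧ a i ≤ M) (hb : ∀ i < 2, 0 ≤ b i ∧ b i ≤ M)
    (hμ : ∀ (n : ℕ) (w : Word 2 2 T n),
      μ (cyl 2 2 T n w) = ENNReal.ofReal (cylWeight 2 2 T a b n w)) :
    ∀ᵐ x ∂(μ.map (gammaMap 2 2 T)), ∀ᶠ n in atTop, x ∈ deepSet n (Nat.sqrt n) := by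
  have hbad : ∀ n k, μ.map (gammaMap 2 2 T) (deepSet n k)ᶜ ≤ ENNReal.ofReal (2 * M ^ k) := by
    intro n k
    rw [Measure.map_apply (measurable_gammaMap T) (measurableSet_deepSet n k).compl]
    have hsub : gammaMap 2 2 T ⁻¹' (deepSet n k)ᶜ ⊆
        {x | ∀ i < k, x (i + n) = ofBinDigits T (fun _ => 0) (i + n)} ∪
        {x | ∀ i < k, x (i + n) = ofBinDigits T (fun _ => 1) (i + n)} := by
      intro x hx
      rw [mem_preimage, mem_compl_iff, gammaMap_eq_ofDigits] at hx
      have hdig : ∀ j (c : Fin 2), binDigits T x j = c → x j = ofBinDigits T (fun _ => c) j := by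
        rintro j c rfl
        rfl
      by_contra hcon
      simp only [mem_union, mem_ofPred_eq, not_or, not_forall] at hcon
      obtain ⟨⟨i, hi, hxi⟩, j, hj, hxj⟩ := hcon
      refine hx (ofDigits_mem_deepSet ⟨j, hj, ?_⟩ ⟨i, hi, ?_⟩)
      · have := mt (hdig (j + n) 1) hxj
        omega
      · have := mt (hdig (i + n) 0) hxi
        omega
    have hMk : 0 ≤ M ^ k := pow_nonneg hM k
    refine (measure_mono hsub).trans ((measure_union_le _ _).trans ?_)
    rw [two_mul, ENNReal.ofReal_add hMk hMk]
    exact add_le_add (measure_run_le ha hb hμ n k _) (measure_run_le ha hb hμ n k _)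
  have hfin : ∑' n : ℕ, μ.map (gammaMap 2 2 T) (deepSet n (Nat.sqrt n))ᶜ ≠ ∞ :=
    ne_top_of_le_ne_top ((summable_pow_natSqrt hM hM1).mul_left 2).tsum_ofReal_ne_top
      (ENNReal.tsum_le_tsum fun n => hbad n (Nat.sqrt n))
  filter_upwards [ae_eventually_notMem hfin] with x hx
  filter_upwards [hx] with n hn
  exact notMem_compl_iff.1 hn

lemma pow_le_map_Idyad {T : ℕ → ℕ} {a b : ℕ → ℝ} {m : ℝ} {μ : Measure (Omg 2 2 T)}
    [IsProbabilityMeasure μ] (hm : 0 ≤ m) (ha : ∀ i < 2, m ≤ a i) (hb : ∀ i < 2, m ≤ b i)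
    (hμ : ∀ (n : ℕ) (w : Word 2 2 T n),
      μ (cyl 2 2 T n w) = ENNReal.ofReal (cylWeight 2 2 T a b n w))
    {n k : ℕ} {x : ℝ} (hx : x ∈ deepSet n k) (hx01 : x ∈ Icc (0 : ℝ) 1) :
    m ^ n ≤ (μ.map (gammaMap 2 2 T) (Idyad n x)).toReal := by
  obtain ⟨d, hd⟩ := exists_digits_cylinder_subset_Idyad hx hx01
  have hsub : cyl 2 2 T n (fun i => ofBinDigits T d i) ⊆ gammaMap 2 2 T ⁻¹' Idyad n x := by
    intro y hy
    rw [mem_preimage, gammaMap_eq_ofDigits]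
    refine hd _ fun i hi => ?_
    have := hy ⟨i, hi⟩
    simp only [binDigits]
    rw [this]
    rfl
  rw [Measure.map_apply (measurable_gammaMap T) (show MeasurableSet (Idyad n x) from measurableSet_Icc),
    ← ENNReal.ofReal_le_iff_le_toReal (measure_ne_top _ _)]
  refine le_trans ?_ (measure_mono hsub)
  rw [hμ]
  exact ENNReal.ofReal_le_ofReal (pow_le_cylWeight hm ha hb n _)

lemma taW_mem_Ioo {p : ℕ → ℝ} (hp : ∀ i < 2, 0 < p i) (q : ℝ) :
    ∀ i < 2, 0 < taW 2 p q i ∧ taW 2 p q i < 1 := by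
  intro i hi
  have h0 := Real.rpow_pos_of_pos (hp 0 two_pos) q
  have h1 := Real.rpow_pos_of_pos (hp 1 one_lt_two) q
  have hs : ∑ j ∈ Finset.range 2, p j ^ q = p 0 ^ q + p 1 ^ q := by simp [Finset.sum_range_succ]
  rw [taW, hs, div_lt_one (by positivity)]
  interval_cases i
  · exact ⟨by positivity, by linarith⟩
  · exact ⟨by positivity, by linarith⟩

/-- Lemma 5.1: for `ν̃_q`-a.e. `x` the local Hölder exponents of `ν`
may be computed along dyadic intervals, `c₁ = c₂ = 2`. -/
theorem stmt16 (T : ℕ → ℕ) (hT1 : T 1 = 1) (hTmono : ∀ k, 1 ≤ k → T k < T (k + 1))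
    (hTrat : Tendsto (fun k => (T (k + 1) : ℝ) / (T k : ℝ)) atTop atTop)
    (a b : ℕ → ℝ) (ha : ∀ i, i < 2 → 0 < a i ∧ a i < 1)
    (hb : ∀ j, j < 2 → 0 < b j ∧ b j < 1)
    (hsa : ∑ i ∈ Finset.range 2, a i = 1) (hsb : ∑ j ∈ Finset.range 2, b j = 1)
    (α : ℝ) (hα1 : -Real.log (sOne 2 2 a b) < α) (hα2 : α < -Real.log (sTwo 2 2 a b))
    (qa qb : ℝ) (hqa : HasDerivAt (theta 2 a) (-α) qa) (hqb : HasDerivAt (theta 2 b) (-α) qb)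
    (μ μt : Measure (Omg 2 2 T)) [IsProbabilityMeasure μ] [IsProbabilityMeasure μt]
    (hμ : ∀ (n : ℕ) (w : Word 2 2 T n),
      μ (cyl 2 2 T n w) = ENNReal.ofReal (cylWeight 2 2 T a b n w))
    (hμt : ∀ (n : ℕ) (w : Word 2 2 T n),
      μt (cyl 2 2 T n w) = ENNReal.ofReal (cylWeight 2 2 T (taW 2 a qa) (taW 2 b qb) n w)) :
    ∀ᵐ x ∂(μt.map (gammaMap 2 2 T)),
      Filter.liminf (fun r : ℝ =>
          Real.log (μ.map (gammaMap 2 2 T) (closedBall x r)).toReal / Real.log r) (𝓝[>] (0 : ℝ)) =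
        Filter.liminf (fun n : ℕ =>
          Real.log (μ.map (gammaMap 2 2 T) (Idyad n x)).toReal / (-((n : ℝ) * Real.log 2))) atTop ∧
      Filter.limsup (fun r : ℝ =>
          Real.log (μ.map (gammaMap 2 2 T) (closedBall x r)).toReal / Real.log r) (𝓝[>] (0 : ℝ)) =
        Filter.limsup (fun n : ℕ =>
          Real.log (μ.map (gammaMap 2 2 T) (Idyad n x)).toReal / (-((n : ℝ) * Real.log 2))) atTop := by
  obtain ⟨m, hm, hma, hmb⟩ : ∃ m : ℝ, 0 < m ∧ (∀ i < 2, m ≤ a i) ∧ ∀ i < 2, m ≤ b i := by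
    refine ⟨min (min (a 0) (a 1)) (min (b 0) (b 1)), ?_, ?_, ?_⟩
    · simp [ha 0, ha 1, hb 0, hb 1]
    all_goals intro i hi; interval_cases i <;> simp
  have hta := taW_mem_Ioo (fun i hi => (ha i hi).1) qa
  have htb := taW_mem_Ioo (fun i hi => (hb i hi).1) qb
  obtain ⟨M, hM1, hMa, hMb⟩ : ∃ M : ℝ, M < 1 ∧ (∀ i < 2, taW 2 a qa i ≤ M) ∧
      ∀ i < 2, taW 2 b qb i ≤ M := by
    refine ⟨max (max (taW 2 a qa 0) (taW 2 a qa 1)) (max (taW 2 b qb 0) (taW 2 b qb 1)), ?_, ?_, ?_⟩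
    · simp [hta 0, hta 1, htb 0, htb 1]
    all_goals intro i hi; interval_cases i <;> simp
  have hM0 : 0 ≤ M := (hta 0 two_pos).1.le.trans (hMa 0 two_pos)
  have h01 : ∀ᵐ x ∂(μt.map (gammaMap 2 2 T)), x ∈ Icc (0 : ℝ) 1 := by
    refine (ae_map_iff (measurable_gammaMap T).aemeasurable measurableSet_Icc).2
      (Eventually.of_forall fun ω => ?_)
    rw [gammaMap_eq_ofDigits]
    exact ⟨Real.ofDigits_nonneg _, Real.ofDigits_le_one _⟩
  have hprob : IsProbabilityMeasure (μ.map (gammaMap 2 2 T)) :=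
    Measure.isProbabilityMeasure_map (measurable_gammaMap T).aemeasurable
  filter_upwards [h01, ae_eventually_mem_deepSet hM0 hM1
    (fun i hi => ⟨(hta i hi).1.le, hMa i hi⟩) (fun i hi => ⟨(htb i hi).1.le, hMb i hi⟩) hμt]
    with x hx hdeep
  refine liminf_limsup_scale_eq hm (fun r => measureReal_le_one)
    (hdeep.mono fun n hn => pow_le_map_Idyad hm.le hma hmb hμ hn hx)
    (hdeep.mono fun n hn r hr => ?_) (hdeep.mono fun n hn r _ hr => ?_)
    (fun n => measureReal_le_one)
  · exact measureReal_mono (Idyad_subset_closedBall hn hr)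
  · exact measureReal_mono (closedBall_subset_Idyad hn hr)

end MF
end
end

section
/- For every $\alpha\in(-\log s_1,-\log s_2)$, the level set $X_\nu(\alpha)$ has full $\tilde\nu_q$-measure: $\tilde\nu_q(X_\nu(\alpha))=1$. -/
open MeasureTheory Metric Set Filter Topology Classical
open scoped ENNReal NNReal

noncomputable section

namespace MF

/-! ### Olsen's multifractal measures and dimension functions on a metric space -/

variable {X : Type} [MetricSpace X]

/-! ### Expansions with variable bases -/

/-- The length `∏_{i<n} (d i)⁻¹` of the intervals of generation `n`. -/
def scale (d : ℕ → ℕ) (n : ℕ) : ℝ := ∏ i ∈ Finset.range n, (d i : ℝ)⁻¹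

/-- The left endpoint of the interval of generation `n` coded by the digits `x`. -/
def digitSum (d x : ℕ → ℕ) (n : ℕ) : ℝ := ∑ i ∈ Finset.range n, (x i : ℝ) * scale d (i + 1)

lemma digitSum_succ (d x : ℕ → ℕ) (n : ℕ) :
    digitSum d x (n + 1) = digitSum d x n + x n * scale d (n + 1) :=
  Finset.sum_range_succ _ _

lemma digitSum_congr {d x y : ℕ → ℕ} {n : ℕ} (h : ∀ i < n, y i = x i) :
    digitSum d y n = digitSum d x n :=
  Finset.sum_congr rfl fun i hi => by rw [h i (Finset.mem_range.1 hi)]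

section Expansion

variable {d : ℕ → ℕ} (hd : ∀ n, 2 ≤ d n)
include hd

lemma scale_pos (n : ℕ) : 0 < scale d n :=
  Finset.prod_pos fun i _ => inv_pos.2 (by exact_mod_cast (by have := hd i; omega : 0 < d i))

lemma mul_scale_succ (n : ℕ) : (d n : ℝ) * scale d (n + 1) = scale d n := by
  have : (d n : ℝ) ≠ 0 := by exact_mod_cast (by have := hd n; omega : d n ≠ 0)
  rw [scale, Finset.prod_range_succ, ← scale]
  field_simp

lemma scale_antitone : Antitone (scale d) := by
  refine antitone_nat_of_succ_le fun n => ?_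
  rw [← mul_scale_succ hd n]
  have h1 : (1 : ℝ) ≤ d n := by exact_mod_cast (by have := hd n; omega : 1 ≤ d n)
  nlinarith [scale_pos hd (n + 1)]

lemma digitSum_mono (x : ℕ → ℕ) : Monotone (digitSum d x) := by
  refine monotone_nat_of_le_succ fun n => ?_
  rw [digitSum_succ]
  have := scale_pos hd (n + 1)
  have : (0 : ℝ) ≤ x n * scale d (n + 1) := by positivity
  linarith

lemma digitSum_add_scale_succ_le {x : ℕ → ℕ} {n : ℕ} (hx : x n < d n) :
    digitSum d x (n + 1) + scale d (n + 1) ≤ digitSum d x n + scale d n := by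
  rw [digitSum_succ, ← mul_scale_succ hd n]
  have h1 : (x n : ℝ) + 1 ≤ d n := by exact_mod_cast hx
  nlinarith [scale_pos hd (n + 1)]

variable {x y : ℕ → ℕ} (hx : ∀ n, x n < d n) (hy : ∀ n, y n < d n)

section
include hx

lemma digitSum_add_scale_antitone : Antitone fun n => digitSum d x n + scale d n :=
  antitone_nat_of_succ_le fun n => digitSum_add_scale_succ_le hd (hx n)

lemma summable_digits : Summable fun n => (x n : ℝ) * scale d (n + 1) := by
  refine summable_of_sum_range_le (c := 1)
    (fun n => mul_nonneg (Nat.cast_nonneg _) (scale_pos hd _).le) fun n => ?_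
  have := digitSum_add_scale_antitone hd hx (Nat.zero_le n)
  have h2 := scale_pos hd n
  simp only [digitSum, scale, Finset.range_zero, Finset.sum_empty, Finset.prod_empty] at this h2
  simp only [scale]
  linarith

lemma tendsto_digitSum :
    Tendsto (digitSum d x) atTop (𝓝 (∑' n, (x n : ℝ) * scale d (n + 1))) :=
  (summable_digits hd hx).hasSum.tendsto_sum_nat

lemma digitSum_le_tsum (n : ℕ) : digitSum d x n ≤ ∑' n, (x n : ℝ) * scale d (n + 1) :=
  (digitSum_mono hd x).ge_of_tendsto (tendsto_digitSum hd hx) n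

lemma tsum_le_digitSum_add_scale (n : ℕ) :
    ∑' n, (x n : ℝ) * scale d (n + 1) ≤ digitSum d x n + scale d n := by
  refine le_of_tendsto (tendsto_digitSum hd hx) ?_
  filter_upwards [eventually_ge_atTop n] with m hm
  have := digitSum_add_scale_antitone hd hx hm
  have h2 := scale_pos hd m
  simp only at this
  linarith

lemma digitSum_add_le_tsum {n m : ℕ} (h : ∃ j, n ≤ j ∧ j < m ∧ x j ≠ 0) :
    digitSum d x n + scale d m ≤ ∑' n, (x n : ℝ) * scale d (n + 1) := by
  obtain ⟨j, hnj, hjm, hj⟩ := h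
  refine le_trans ?_ (digitSum_le_tsum hd hx (j + 1))
  rw [digitSum_succ]
  have h1 := digitSum_mono hd x hnj
  have h2 := scale_antitone hd (Nat.succ_le_of_lt hjm)
  have h3 : (1 : ℝ) ≤ x j := by exact_mod_cast Nat.one_le_iff_ne_zero.2 hj
  have h4 := scale_pos hd (j + 1)
  simp only [Nat.succ_eq_add_one] at h2
  nlinarith

lemma tsum_add_le_digitSum {n m : ℕ} (h : ∃ j, n ≤ j ∧ j < m ∧ x j ≠ d j - 1) :
    (∑' n, (x n : ℝ) * scale d (n + 1)) + scale d m ≤ digitSum d x n + scale d n := by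
  obtain ⟨j, hnj, hjm, hj⟩ := h
  have h0 := tsum_le_digitSum_add_scale hd hx (j + 1)
  rw [digitSum_succ] at h0
  have h1 := digitSum_add_scale_antitone hd hx hnj
  simp only at h1
  have h2 := scale_antitone hd (Nat.succ_le_of_lt hjm)
  have h3 : (x j : ℝ) + 2 ≤ d j := by
    have := hx j
    exact_mod_cast (by omega : x j + 2 ≤ d j)
  have h4 := scale_pos hd (j + 1)
  have h5 := mul_scale_succ hd j
  simp only [Nat.succ_eq_add_one] at h2
  nlinarith

end

include hx hy

lemma abs_tsum_sub_tsum_le {n : ℕ} (h : ∀ i < n, y i = x i) :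
    |(∑' n, (y n : ℝ) * scale d (n + 1)) - ∑' n, (x n : ℝ) * scale d (n + 1)| ≤ scale d n := by
  have h1 := digitSum_le_tsum hd hx n
  have h2 := tsum_le_digitSum_add_scale hd hx n
  have h3 := digitSum_le_tsum hd hy n
  have h4 := tsum_le_digitSum_add_scale hd hy n
  rw [digitSum_congr h] at h3 h4
  rw [abs_le]
  constructor <;> linarith

lemma tsum_le_or_le_tsum {n : ℕ} (h : ∃ i < n, y i ≠ x i) :
    ∑' n, (y n : ℝ) * scale d (n + 1) ≤ digitSum d x n ∨
      digitSum d x n + scale d n ≤ ∑' n, (y n : ℝ) * scale d (n + 1) := by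
  have hlow : ∀ j < Nat.find h, y j = x j := fun j hj => by
    have := Nat.find_min h hj
    push Not at this
    exact this (hj.trans (Nat.find_spec h).1)
  obtain ⟨hin, hne⟩ := Nat.find_spec h
  set i := Nat.find h
  have h4 := scale_pos hd (i + 1)
  rcases lt_or_gt_of_ne hne with hlt | hgt
  · left
    have h1 := tsum_le_digitSum_add_scale hd hy (i + 1)
    have h2 := digitSum_mono hd x (Nat.succ_le_of_lt hin)
    rw [Nat.succ_eq_add_one, digitSum_succ] at h2
    rw [digitSum_succ, digitSum_congr hlow] at h1
    have h3 : (y i : ℝ) + 1 ≤ x i := by exact_mod_cast hlt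
    nlinarith
  · right
    have h1 := digitSum_le_tsum hd hy (i + 1)
    have h2 := digitSum_add_scale_antitone hd hx (Nat.succ_le_of_lt hin)
    simp only [Nat.succ_eq_add_one] at h2
    rw [digitSum_succ] at h2
    rw [digitSum_succ, digitSum_congr hlow] at h1
    have h3 : (x i : ℝ) + 1 ≤ y i := by exact_mod_cast hgt
    nlinarith

lemma digits_eq_of_abs_sub_lt {n m : ℕ}
    (h0 : ∃ j, n ≤ j ∧ j < m ∧ x j ≠ 0) (h1 : ∃ j, n ≤ j ∧ j < m ∧ x j ≠ d j - 1)
    (hxy : |(∑' n, (y n : ℝ) * scale d (n + 1)) - ∑' n, (x n : ℝ) * scale d (n + 1)|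
      < scale d m) :
    ∀ i < n, y i = x i := by
  by_contra! h
  have h2 := digitSum_add_le_tsum hd hx h0
  have h3 := tsum_add_le_digitSum hd hx h1
  rw [abs_lt] at hxy
  rcases tsum_le_or_le_tsum hd hx hy h with h4 | h4 <;> linarith [hxy.1, hxy.2]

end Expansion

/-! ### Logarithmic asymptotics along scales -/

lemma exists_index_tendsto {u : ℕ → ℝ} (hpos : ∀ n, 0 < u n) (hu : Tendsto u atTop (𝓝 0)) :
    ∃ k : ℝ → ℕ, Tendsto k (𝓝[>] 0) atTop ∧
      ∀ᶠ r in 𝓝[>] (0 : ℝ), u (k r + 1) ≤ r ∧ r < u (k r) := by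
  have hex : ∀ r : ℝ, 0 < r → ∃ n, u (n + 1) ≤ r := fun r hr =>
    (((tendsto_add_atTop_iff_nat 1).2 hu).eventually (ge_mem_nhds hr)).exists
  have hsmall : ∀ N : ℕ, ∀ᶠ r in 𝓝[>] (0 : ℝ), ∀ j ≤ N, r < u j := fun N => by
    have : ∀ᶠ r in 𝓝[>] (0 : ℝ), ∀ j ∈ Finset.range (N + 1), r < u j :=
      (Filter.eventually_all_finset _).2 fun j _ =>
        nhdsWithin_le_nhds (eventually_lt_nhds (hpos j))
    filter_upwards [this] with r hr j hj
    exact hr j (Finset.mem_range.2 (by omega))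
  refine ⟨fun r => if h : ∃ n, u (n + 1) ≤ r then Nat.find h else 0, ?_, ?_⟩
  · refine tendsto_atTop.2 fun N => ?_
    filter_upwards [hsmall (N + 1), self_mem_nhdsWithin] with r hr hr0
    rw [dif_pos (hex r hr0)]
    by_contra! hlt
    exact absurd (Nat.find_spec (hex r hr0)) (not_le.2 (hr _ (by omega)))
  · filter_upwards [hsmall 0, self_mem_nhdsWithin] with r hr hr0
    rw [dif_pos (hex r hr0)]
    refine ⟨Nat.find_spec (hex r hr0), ?_⟩
    rcases hk : Nat.find (hex r hr0) with _ | k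
    · exact hr 0 le_rfl
    · exact not_le.1 (Nat.find_min (hex r hr0) (by omega : k < Nat.find (hex r hr0)))

lemma tendsto_log_div_log_of_scales {F : ℝ → ℝ} {p s : ℕ → ℝ} {M : ℕ → ℕ} {α : ℝ}
    (hs : ∀ n, 0 < s n) (hs0 : Tendsto s atTop (𝓝 0))
    (hM : Tendsto M atTop atTop) (hp : ∀ n, 0 < p n) (hp1 : ∀ n, p n ≤ 1)
    (hlow : ∀ n r, s n ≤ r → p n ≤ F r)
    (hup : ∀ᶠ n in atTop, ∀ r, 0 < r → r < s (M n) → F r ≤ p n)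
    (hlim : Tendsto (fun n => Real.log (p n) / Real.log (s n)) atTop (𝓝 α))
    (hratio : Tendsto (fun n => Real.log (s n) / Real.log (s (n + 1))) atTop (𝓝 1))
    (hratioM : Tendsto (fun n => Real.log (s n) / Real.log (s (M (n + 1)))) atTop (𝓝 1)) :
    Tendsto (fun r => Real.log (F r) / Real.log r) (𝓝[>] 0) (𝓝 α) := by
  have hlog : ∀ᶠ n in atTop, Real.log (s n) ≠ 0 := by
    filter_upwards [hs0.eventually (gt_mem_nhds one_pos)] with n hn
    exact (Real.log_neg (hs n) hn).ne
  have hlim1 : Tendsto (fun n => Real.log (p (n + 1)) / Real.log (s n)) atTop (𝓝 α) := by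
    have := ((tendsto_add_atTop_iff_nat 1).2 hlim).div hratio one_ne_zero
    rw [div_one] at this
    refine this.congr' ?_
    filter_upwards [hlog, (tendsto_add_atTop_nat 1).eventually hlog] with n h1 h2
    simp only [Pi.div_apply]
    field_simp
  have hlim2 : Tendsto (fun n => Real.log (p n) / Real.log (s (M (n + 1)))) atTop (𝓝 α) := by
    have := hlim.mul hratioM
    rw [mul_one] at this
    refine this.congr' ?_
    filter_upwards [hlog] with n h1
    field_simp
  obtain ⟨k, hk, hks⟩ := exists_index_tendsto hs hs0
  obtain ⟨k', hk', hks'⟩ := exists_index_tendsto (fun n => hs (M n)) (hs0.comp hM)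
  have hr1 : ∀ᶠ r : ℝ in 𝓝[>] 0, r < 1 := nhdsWithin_le_nhds (eventually_lt_nhds one_pos)
  refine tendsto_of_tendsto_of_tendsto_of_le_of_le' (hlim2.comp hk') (hlim1.comp hk) ?_ ?_
  · filter_upwards [hks, hks', hk'.eventually hup, hr1, self_mem_nhdsWithin]
      with r h1 h2 h3 hr1 hr
    have hF : F r ≤ p (k' r) := h3 r hr h2.2
    have hF0 : 0 < F r := (hp _).trans_le (hlow _ r h1.1)
    have e1 : Real.log (F r) ≤ Real.log (p (k' r)) := Real.log_le_log hF0 hF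
    have e2 : Real.log (s (M (k' r + 1))) ≤ Real.log r := Real.log_le_log (hs _) h2.1
    have e3 : Real.log r < 0 := Real.log_neg hr hr1
    have e4 : Real.log (p (k' r)) ≤ 0 := Real.log_nonpos (hp _).le (hp1 _)
    simp only [Function.comp]
    rw [← neg_div_neg_eq (Real.log (p _)), ← neg_div_neg_eq (Real.log (F r))]
    exact div_le_div₀ (by linarith) (by linarith) (by linarith) (by linarith)
  · filter_upwards [hks, hk.eventually (hs0.eventually (gt_mem_nhds one_pos)),
      self_mem_nhdsWithin] with r h1 h2 hr
    have e1 : Real.log (p (k r + 1)) ≤ Real.log (F r) := Real.log_le_log (hp _) (hlow _ r h1.1)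
    have e2 : Real.log r ≤ Real.log (s (k r)) := Real.log_le_log hr h1.2.le
    have e3 : Real.log (s (k r)) < 0 := Real.log_neg (hs _) h2
    have e4 : Real.log (p (k r + 1)) ≤ 0 := Real.log_nonpos (hp _).le (hp1 _)
    simp only [Function.comp]
    rw [← neg_div_neg_eq (Real.log (p _)), ← neg_div_neg_eq (Real.log (F r))]
    exact div_le_div₀ (by linarith) (by linarith) (by linarith) (by linarith)

lemma exists_summable_pow_sublinear {ρ : ℝ} (h0 : 0 < ρ) (h1 : ρ < 1) :
    ∃ m : ℕ → ℕ, Summable (fun n => ρ ^ m n) ∧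
      Tendsto (fun n => ((m (n + 1) : ℝ) + 1) / n) atTop (𝓝 0) := by
  have hlρ : 0 < -Real.log ρ := by linarith [Real.log_neg h0 h1]
  set K : ℝ := 2 / -Real.log ρ with hK
  have hK0 : 0 < K := by positivity
  refine ⟨fun n => ⌈K * Real.log n⌉₊, ?_, ?_⟩
  · have hsum : Summable fun n : ℕ => ((n : ℝ) ^ 2)⁻¹ :=
      Real.summable_nat_pow_inv.2 one_lt_two
    refine Summable.of_norm_bounded_eventually_nat hsum ?_
    filter_upwards [eventually_ge_atTop 1] with n hn
    have hn0 : (0 : ℝ) < n := by exact_mod_cast hn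
    rw [Real.norm_of_nonneg (by positivity), ← Real.rpow_natCast ρ]
    have hc : K * Real.log n ≤ (⌈K * Real.log n⌉₊ : ℝ) := Nat.le_ceil _
    refine (Real.rpow_le_rpow_of_exponent_ge h0 h1.le hc).trans_eq ?_
    have hne : Real.log ρ ≠ 0 := by linarith
    have e : Real.log ρ * (K * Real.log n) = -(((2 : ℕ) : ℝ) * Real.log n) := by
      rw [hK]
      push_cast
      field_simp
    rw [Real.rpow_def_of_pos h0, e, Real.exp_neg, ← Real.log_pow, Real.exp_log (by positivity)]
  · have hlog : Tendsto (fun n : ℕ => Real.log n / n) atTop (𝓝 0) :=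
      Real.isLittleO_log_id_atTop.tendsto_div_nhds_zero.comp tendsto_natCast_atTop_atTop
    have hinv : Tendsto (fun n : ℕ => (2 + K * Real.log 2) / (n : ℝ)) atTop (𝓝 0) :=
      tendsto_const_div_atTop_nhds_zero_nat _
    have hup := (hlog.const_mul K).add hinv
    rw [mul_zero, add_zero] at hup
    refine squeeze_zero' (Eventually.of_forall fun n => by positivity) ?_ hup
    filter_upwards [eventually_ge_atTop 1] with n hn
    have hn1 : (1 : ℝ) ≤ n := by exact_mod_cast hn
    have hc := Nat.ceil_lt_add_one (mul_nonneg hK0.le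
      (Real.log_nonneg (by push_cast; linarith : (1 : ℝ) ≤ ((n + 1 : ℕ) : ℝ))))
    have hl : Real.log ((n + 1 : ℕ) : ℝ) ≤ Real.log 2 + Real.log n := by
      rw [← Real.log_mul two_ne_zero (by linarith)]
      exact Real.log_le_log (by positivity) (by push_cast; linarith)
    rw [← mul_div_assoc, ← add_div]
    refine div_le_div_of_nonneg_right ?_ (by linarith)
    nlinarith

section ScaleLog

variable {d : ℕ → ℕ} (hd : ∀ n, 2 ≤ d n)
include hd

lemma neg_log_scale (n : ℕ) : -Real.log (scale d n) = ∑ i ∈ Finset.range n, Real.log (d i) := by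
  rw [scale, Real.log_prod fun i _ => inv_ne_zero (by
    exact_mod_cast (by have := hd i; omega : d i ≠ 0)), ← Finset.sum_neg_distrib]
  simp

lemma mul_log_two_le_neg_log_scale (n : ℕ) : n * Real.log 2 ≤ -Real.log (scale d n) := by
  rw [neg_log_scale hd, ← nsmul_eq_mul]
  simpa using Finset.card_nsmul_le_sum (Finset.range n) (fun i => Real.log (d i)) (Real.log 2)
    fun i _ => Real.log_le_log two_pos (by exact_mod_cast hd i)

lemma tendsto_scale : Tendsto (scale d) atTop (𝓝 0) := by
  have h : Tendsto (fun n => Real.log (scale d n)) atTop atBot := by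
    rw [← tendsto_neg_atTop_iff]
    exact tendsto_atTop_mono (mul_log_two_le_neg_log_scale hd)
      (tendsto_natCast_atTop_atTop.atTop_mul_const (Real.log_pos one_lt_two))
  exact (Real.tendsto_exp_atBot.comp h).congr fun n => Real.exp_log (scale_pos hd n)

lemma tendsto_log_scale_ratio {C : ℕ} (hC : ∀ n, d n ≤ C) {M : ℕ → ℕ} (hM : ∀ n, n ≤ M n)
    (hlim : Tendsto (fun n => ((M n : ℝ) - n) / n) atTop (𝓝 0)) :
    Tendsto (fun n => Real.log (scale d n) / Real.log (scale d (M n))) atTop (𝓝 1) := by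
  have hl2 := Real.log_pos one_lt_two
  have hlC : 0 ≤ Real.log C := Real.log_natCast_nonneg C
  have key : Tendsto (fun n => Real.log (scale d (M n)) / Real.log (scale d n)) atTop (𝓝 1) := by
    have hup : Tendsto (fun n => 1 + Real.log C / Real.log 2 * (((M n : ℝ) - n) / n)) atTop
        (𝓝 1) := by
      simpa using (hlim.const_mul (Real.log C / Real.log 2)).const_add 1
    have hbd : ∀ᶠ n in atTop, 1 ≤ Real.log (scale d (M n)) / Real.log (scale d n) ∧
        Real.log (scale d (M n)) / Real.log (scale d n) ≤
          1 + Real.log C / Real.log 2 * (((M n : ℝ) - n) / n) := by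
      filter_upwards [eventually_ge_atTop 1] with n hn
      have hn0 : (0 : ℝ) < n := by exact_mod_cast hn
      have h1 := mul_log_two_le_neg_log_scale hd n
      have hpos : 0 < -Real.log (scale d n) := lt_of_lt_of_le (by positivity) h1
      have hdiff : -Real.log (scale d (M n)) - -Real.log (scale d n) =
          ∑ i ∈ Finset.Ico n (M n), Real.log (d i) := by
        rw [neg_log_scale hd, neg_log_scale hd, Finset.sum_Ico_eq_sub _ (hM n)]
      have hnonneg : 0 ≤ ∑ i ∈ Finset.Ico n (M n), Real.log (d i) :=
        Finset.sum_nonneg fun i _ => Real.log_natCast_nonneg _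
      have hle : ∑ i ∈ Finset.Ico n (M n), Real.log (d i) ≤ ((M n : ℝ) - n) * Real.log C := by
        rw [← Nat.cast_sub (hM n), ← nsmul_eq_mul, ← Nat.card_Ico]
        exact Finset.sum_le_card_nsmul _ _ _ fun i _ => Real.log_le_log
          (by exact_mod_cast (by have := hd i; omega : 0 < d i)) (by exact_mod_cast hC i)
      have hMn : (0 : ℝ) ≤ (M n : ℝ) - n := sub_nonneg.2 (by exact_mod_cast hM n)
      have e : Real.log (scale d (M n)) / Real.log (scale d n) =
          1 + (∑ i ∈ Finset.Ico n (M n), Real.log (d i)) / -Real.log (scale d n) := by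
        rw [← hdiff, sub_div, div_self hpos.ne', neg_div_neg_eq]
        ring
      rw [e]
      refine ⟨le_add_of_nonneg_right (by positivity), ?_⟩
      rw [div_mul_div_comm, mul_comm (Real.log C), mul_comm (Real.log 2)]
      gcongr
    exact tendsto_of_tendsto_of_tendsto_of_le_of_le' tendsto_const_nhds hup
      (hbd.mono fun _ h => h.1) (hbd.mono fun _ h => h.2)
  have := key.inv₀ one_ne_zero
  simpa using this

end ScaleLog

/-! ### Almost sure behaviour of independent digits -/

open ProbabilityTheory in
lemma ae_eventually_sum_lt {Ω : Type} [MeasurableSpace Ω] {μ : Measure Ω} [IsProbabilityMeasure μ]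
    {Z : ℕ → Ω → ℝ} (hmeas : ∀ n, Measurable (Z n)) (hind : iIndepFun Z μ) {B : ℝ} (hB : 0 < B)
    (hbd : ∀ n ω, |Z n ω| ≤ B) (hmean : ∀ n, ∫ ω, Z n ω ∂μ = 0) {ε : ℝ} (hε : 0 < ε) :
    ∀ᵐ ω ∂μ, ∀ᶠ n : ℕ in atTop, ∑ i ∈ Finset.range n, Z i ω < ε * n := by
  set c : ℝ≥0 := (‖B - (-B)‖₊ / 2) ^ 2 with hc
  have hc0 : (0 : ℝ) < c := by
    have : (0 : ℝ) < ‖B - (-B)‖ := norm_pos_iff.2 (by linarith)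
    rw [hc]
    push_cast
    positivity
  have hsub : ∀ i, HasSubgaussianMGF (Z i) c μ := fun i =>
    hasSubgaussianMGF_of_mem_Icc_of_integral_eq_zero (hmeas i).aemeasurable
      (Eventually.of_forall fun ω => abs_le.1 (hbd i ω)) (hmean i)
  have hle : ∀ n : ℕ, μ {ω | ε * n ≤ ∑ i ∈ Finset.range n, Z i ω} ≤
      ENNReal.ofReal (Real.exp (n * (-(ε ^ 2 / (2 * c))))) := fun n => by
    rw [← ofReal_measureReal]
    refine ENNReal.ofReal_le_ofReal ((HasSubgaussianMGF.measure_sum_range_ge_le_of_iIndepFun hind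
      (fun i _ => hsub i) (by positivity)).trans_eq ?_)
    congr 1
    rcases eq_or_ne n 0 with rfl | hn
    · simp
    · field_simp
  have hsum : Summable fun n : ℕ => Real.exp (n * (-(ε ^ 2 / (2 * c)))) :=
    Real.summable_exp_nat_mul_iff.2 (neg_lt_zero.2 (by positivity))
  filter_upwards [ae_eventually_notMem
    (ne_top_of_le_ne_top hsum.tsum_ofReal_ne_top (ENNReal.tsum_le_tsum hle))] with ω hω
  filter_upwards [hω] with n hn
  exact not_le.1 hn

open ProbabilityTheory in
/-- A strong law of large numbers for centered, uniformly bounded, independent variables. -/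
lemma strong_law_of_bounded {Ω : Type} [MeasurableSpace Ω] {μ : Measure Ω}
    [IsProbabilityMeasure μ] {Z : ℕ → Ω → ℝ} (hmeas : ∀ n, Measurable (Z n))
    (hind : iIndepFun Z μ) {B : ℝ} (hbd : ∀ n ω, |Z n ω| ≤ B) (hmean : ∀ n, ∫ ω, Z n ω ∂μ = 0) :
    ∀ᵐ ω ∂μ, Tendsto (fun n : ℕ => (∑ i ∈ Finset.range n, Z i ω) / n) atTop (𝓝 0) := by
  have hB : 0 < |B| + 1 := by positivity
  have hbd' : ∀ n ω, |Z n ω| ≤ |B| + 1 := fun n ω => by linarith [hbd n ω, le_abs_self B]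
  have hup : ∀ᵐ ω ∂μ, ∀ k : ℕ, ∀ᶠ n : ℕ in atTop,
      ∑ i ∈ Finset.range n, Z i ω < 1 / ((k : ℝ) + 1) * n :=
    ae_all_iff.2 fun k => ae_eventually_sum_lt hmeas hind hB hbd' hmean (by positivity)
  have hlow : ∀ᵐ ω ∂μ, ∀ k : ℕ, ∀ᶠ n : ℕ in atTop,
      ∑ i ∈ Finset.range n, -Z i ω < 1 / ((k : ℝ) + 1) * n :=
    ae_all_iff.2 fun k => ae_eventually_sum_lt (Z := fun i ω => -Z i ω)
      (fun i => (hmeas i).neg) (hind.comp (fun _ t => -t) fun _ => measurable_neg) hB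
      (fun n ω => by rw [abs_neg]; exact hbd' n ω)
      (fun n => by rw [integral_neg, hmean, neg_zero]) (by positivity)
  filter_upwards [hup, hlow] with ω h1 h2
  rw [Metric.tendsto_atTop']
  intro ε hε
  obtain ⟨k, hk⟩ := exists_nat_one_div_lt hε
  obtain ⟨N, hN⟩ := eventually_atTop.1 ((h1 k).and (h2 k))
  refine ⟨N, fun n hn => ?_⟩
  obtain ⟨h3, h4⟩ := hN n hn.le
  have hn0 : (0 : ℝ) < n := by exact_mod_cast (by omega : 0 < n)
  rw [Finset.sum_neg_distrib] at h4
  rw [Real.dist_eq, sub_zero, abs_div, abs_of_pos hn0, div_lt_iff₀ hn0]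
  have : 1 / ((k : ℝ) + 1) * n < ε * n := by gcongr
  exact abs_lt.2 ⟨by linarith, by linarith⟩

/-- The law on `Fin c` with weights `w`. -/
def digitLaw (c : ℕ) (w : ℕ → ℝ) : Measure (Fin c) :=
  ∑ k : Fin c, ENNReal.ofReal (w k) • Measure.dirac k

lemma digitLaw_singleton (c : ℕ) (w : ℕ → ℝ) (k : Fin c) :
    digitLaw c w {k} = ENNReal.ofReal (w k) := by
  simp [digitLaw, Measure.finsetSum_apply, Set.indicator_apply]

lemma isProbabilityMeasure_digitLaw {c : ℕ} {w : ℕ → ℝ} (h0 : ∀ k < c, 0 ≤ w k)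
    (h1 : ∑ k ∈ Finset.range c, w k = 1) : IsProbabilityMeasure (digitLaw c w) := by
  constructor
  simp only [digitLaw, Measure.finsetSum_apply, Measure.smul_apply, measure_univ, smul_eq_mul,
    mul_one]
  rw [← ENNReal.ofReal_sum_of_nonneg fun (k : Fin c) _ => h0 k k.2,
    Fin.sum_univ_eq_sum_range w, h1,
    ENNReal.ofReal_one]

lemma integral_digitLaw {c : ℕ} {w g : ℕ → ℝ} (h0 : ∀ k < c, 0 ≤ w k)
    [IsProbabilityMeasure (digitLaw c w)] :
    ∫ k : Fin c, g k ∂(digitLaw c w) = ∑ k ∈ Finset.range c, w k * g k := by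
  rw [integral_fintype .of_finite, ← Fin.sum_univ_eq_sum_range (fun k => w k * g k)]
  refine Finset.sum_congr rfl fun k _ => ?_
  rw [Measure.real, digitLaw_singleton, ENNReal.toReal_ofReal (h0 k k.2), smul_eq_mul]

/-- `m` gives to every cylinder the product of the weights of its digits. -/
def HasCylinderWeights {d : ℕ → ℕ} (m : Measure (∀ n, Fin (d n))) (w : ℕ → ℕ → ℝ) : Prop :=
  ∀ (n : ℕ) (v : ∀ i : Fin n, Fin (d i)),
    m {y | ∀ i : Fin n, y i = v i} = ENNReal.ofReal (∏ i : Fin n, w i (v i))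

lemma HasCylinderWeights.measure_prefix {d : ℕ → ℕ} {m : Measure (∀ n, Fin (d n))}
    {w : ℕ → ℕ → ℝ} (h : HasCylinderWeights m w) (x : ∀ n, Fin (d n)) (n : ℕ) :
    m {y | ∀ i < n, y i = x i} = ENNReal.ofReal (∏ i ∈ Finset.range n, w i (x i)) := by
  rw [Finset.prod_range fun i => w i (x i), ← h n fun i => x i]
  congr 1
  ext y
  exact ⟨fun hy i => hy i i.2, fun hy i hi => hy ⟨i, hi⟩⟩

lemma measurableSet_wordCylinder {d : ℕ → ℕ} (n : ℕ) (v : ∀ i : Fin n, Fin (d i)) :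
    MeasurableSet {y : ∀ n, Fin (d n) | ∀ i : Fin n, y i = v i} := by
  rw [Set.ofPred_forall]
  exact MeasurableSet.iInter fun i =>
    (measurable_pi_apply (i : ℕ) : Measurable fun y : ∀ n, Fin (d n) => y i)
      (measurableSet_singleton (v i))

lemma measurableSet_prefix {d : ℕ → ℕ} (x : ∀ n, Fin (d n)) (n : ℕ) :
    MeasurableSet {y : ∀ n, Fin (d n) | ∀ i < n, y i = x i} := by
  convert measurableSet_wordCylinder n fun i => x i using 1
  ext y
  exact ⟨fun hy i => hy i i.2, fun hy i hi => hy ⟨i, hi⟩⟩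

lemma pi_eq_generateFrom_wordCylinders (d : ℕ → ℕ) :
    (MeasurableSpace.pi : MeasurableSpace (∀ n, Fin (d n))) = MeasurableSpace.generateFrom
      {s | ∃ (n : ℕ) (v : ∀ i : Fin n, Fin (d i)), s = {y | ∀ i : Fin n, y i = v i}} := by
  refine le_antisymm ?_ (MeasurableSpace.generateFrom_le ?_)
  · refine iSup_le fun n => measurable_iff_comap_le.1 ?_
    refine @measurable_to_countable' _ _ _ _ (_) _ fun k => ?_
    have : (fun y : ∀ n, Fin (d n) => y n) ⁻¹' {k} =
        ⋃ v ∈ {v : ∀ i : Fin (n + 1), Fin (d i) | v (Fin.last n) = k},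
          {y : ∀ n, Fin (d n) | ∀ i : Fin (n + 1), y i = v i} := by
      ext y
      simp only [mem_preimage, mem_singleton_iff, mem_ofPred_eq, mem_iUnion, exists_prop]
      exact ⟨fun h => ⟨fun i => y i, h, fun _ => rfl⟩, fun ⟨v, hv, hy⟩ => hv ▸ hy (Fin.last n)⟩
    rw [this]
    refine MeasurableSet.biUnion (Set.to_countable _) fun v _ => ?_
    exact MeasurableSpace.measurableSet_generateFrom ⟨n + 1, v, rfl⟩
  · rintro s ⟨n, v, rfl⟩
    exact measurableSet_wordCylinder n v

lemma isPiSystem_wordCylinders (d : ℕ → ℕ) :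
    IsPiSystem {s : Set (∀ n, Fin (d n)) |
      ∃ (n : ℕ) (v : ∀ i : Fin n, Fin (d i)), s = {y | ∀ i : Fin n, y i = v i}} := by
  rintro _ ⟨n, v, rfl⟩ _ ⟨m, u, rfl⟩ ⟨x, hx1, hx2⟩
  refine ⟨max n m, fun i => x i, ?_⟩
  ext y
  simp only [mem_inter_iff, mem_ofPred_eq] at hx1 hx2 ⊢
  constructor
  · rintro ⟨h1, h2⟩ i
    rcases lt_max_iff.1 i.2 with h | h
    · exact (h1 ⟨i, h⟩).trans (hx1 ⟨i, h⟩).symm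
    · exact (h2 ⟨i, h⟩).trans (hx2 ⟨i, h⟩).symm
  · intro h
    exact ⟨fun i => (h ⟨i, i.2.trans_le (le_max_left _ _)⟩).trans (hx1 i),
      fun i => (h ⟨i, i.2.trans_le (le_max_right _ _)⟩).trans (hx2 i)⟩

lemma HasCylinderWeights.eq_infinitePi {d : ℕ → ℕ} {m : Measure (∀ n, Fin (d n))}
    [IsProbabilityMeasure m] {w : ℕ → ℕ → ℝ} (h : HasCylinderWeights m w)
    (h0 : ∀ n, ∀ k < d n, 0 ≤ w n k) [∀ n, IsProbabilityMeasure (digitLaw (d n) (w n))] :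
    m = Measure.infinitePi fun n => digitLaw (d n) (w n) := by
  refine ext_of_generate_finite _ (pi_eq_generateFrom_wordCylinders d)
    (isPiSystem_wordCylinders d) ?_ (by simp)
  rintro _ ⟨n, v, rfl⟩
  rw [h n v]
  have hset : {y : ∀ n, Fin (d n) | ∀ i : Fin n, y i = v i} =
      Set.pi (Finset.range n) fun i => if hi : i < n then ({v ⟨i, hi⟩} : Set (Fin (d i))) else univ := by
    ext y
    simp only [mem_ofPred_eq, Set.mem_pi, Finset.coe_range, mem_Iio]
    refine ⟨fun hy i hi => ?_, fun hy i => ?_⟩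
    · rw [dif_pos hi]
      exact hy ⟨i, hi⟩
    · simpa using hy i i.2
  rw [hset, Measure.infinitePi_pi _ fun i _ => MeasurableSet.of_discrete, Finset.prod_range,
    ENNReal.ofReal_prod_of_nonneg fun (i : Fin n) _ => h0 i _ (v i).2]
  refine Finset.prod_congr rfl fun i _ => ?_
  rw [dif_pos i.2, digitLaw_singleton]

section Product

variable {d : ℕ → ℕ} {w : ℕ → ℕ → ℝ} [∀ n, IsProbabilityMeasure (digitLaw (d n) (w n))]

open ProbabilityTheory in
lemma ae_tendsto_sum_digits_div (h0 : ∀ n, ∀ k < d n, 0 ≤ w n k) {g : ℕ → ℕ → ℝ} {B : ℝ}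
    (hg : ∀ n, ∀ k < d n, |g n k| ≤ B)
    (hmean : ∀ n, ∑ k ∈ Finset.range (d n), w n k * g n k = 0) :
    ∀ᵐ x ∂(Measure.infinitePi fun n => digitLaw (d n) (w n)),
      Tendsto (fun n : ℕ => (∑ i ∈ Finset.range n, g i (x i)) / n) atTop (𝓝 0) := by
  refine strong_law_of_bounded (Z := fun i (x : ∀ n, Fin (d n)) => g i (x i)) (B := B)
    (fun i => (Measurable.of_discrete (f := fun k : Fin (d i) => g i k)).comp
      (measurable_pi_apply i))
    (iIndepFun_infinitePi (X := fun i (k : Fin (d i)) => g i k) fun _ => Measurable.of_discrete)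
    (fun i x => hg i _ (x i).2) fun i => ?_
  rw [← hmean i, ← integral_digitLaw (h0 i)]
  rw [← Measure.infinitePi_map_eval (fun n => digitLaw (d n) (w n)) i, integral_map
    (measurable_pi_apply i).aemeasurable
    (Measurable.of_discrete (f := fun k : Fin (d i) => g i k)).aestronglyMeasurable]

lemma ae_eventually_exists_ne {ρ : ℝ} (hρ : ∀ n, ∀ k < d n, w n k ≤ ρ) {m : ℕ → ℕ}
    (hm : Summable fun n => ρ ^ m n) (h0 : 0 ≤ ρ) (z : ∀ n, Fin (d n)) :
    ∀ᵐ x ∂(Measure.infinitePi fun n => digitLaw (d n) (w n)),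
      ∀ᶠ n in atTop, ∃ j, n ≤ j ∧ j < n + m n ∧ x j ≠ z j := by
  have hle : ∀ n, Measure.infinitePi (fun n => digitLaw (d n) (w n))
      (Set.pi (Finset.Ico n (n + m n)) fun i => {z i}) ≤ ENNReal.ofReal (ρ ^ m n) := fun n => by
    rw [Measure.infinitePi_pi _ fun i _ => measurableSet_singleton _]
    refine (Finset.prod_le_pow_card _ _ (ENNReal.ofReal ρ) fun i _ => ?_).trans_eq ?_
    · rw [digitLaw_singleton]
      exact ENNReal.ofReal_le_ofReal (hρ i _ (z i).2)
    · rw [Nat.card_Ico, Nat.add_sub_cancel_left, ENNReal.ofReal_pow h0]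
  filter_upwards [ae_eventually_notMem
    (ne_top_of_le_ne_top hm.tsum_ofReal_ne_top (ENNReal.tsum_le_tsum hle))] with x hx
  filter_upwards [hx] with n hn
  by_contra! hcon
  refine hn fun j hj => ?_
  rw [Finset.coe_Ico, mem_Ico] at hj
  exact hcon j hj.1 hj.2

end Product

/-! ### Local dimension of the projected measure -/

section LocalDimension

variable {d : ℕ → ℕ} (hd : ∀ n, 2 ≤ d n)
include hd

lemma measurable_tsum_digits :
    Measurable fun x : ∀ n, Fin (d n) => ∑' n, ((x n : ℕ) : ℝ) * scale d (n + 1) := by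
  refine measurable_of_tendsto_metrizable
    (f := fun n (x : ∀ n, Fin (d n)) => digitSum d (fun i => x i) n) (fun n => ?_)
    (tendsto_pi_nhds.2 fun x => tendsto_digitSum hd fun n => (x n).2)
  exact Finset.measurable_sum _ fun i _ =>
    (Measurable.of_discrete (f := fun k : Fin (d i) => ((k : ℕ) : ℝ) * scale d (i + 1))).comp
      (measurable_pi_apply i)

lemma tendsto_log_prod_div_log_scale {p : ℕ → ℝ} (hp : ∀ n, 0 < p n) {α : ℝ}
    (h : Tendsto (fun n : ℕ => (∑ i ∈ Finset.range n, (Real.log (p i) + α * Real.log (d i))) / n)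
      atTop (𝓝 0)) :
    Tendsto (fun n => Real.log (∏ i ∈ Finset.range n, p i) / Real.log (scale d n)) atTop
      (𝓝 α) := by
  have hl2 := Real.log_pos one_lt_two
  rw [tendsto_iff_norm_sub_tendsto_zero]
  have hup := h.norm.div_const (Real.log 2)
  rw [norm_zero, zero_div] at hup
  refine squeeze_zero' (Eventually.of_forall fun n => norm_nonneg _) ?_ hup
  filter_upwards [eventually_ge_atTop 1] with n hn
  have hn0 : (0 : ℝ) < n := by exact_mod_cast hn
  have hs := mul_log_two_le_neg_log_scale hd n
  have hs0 : 0 < -Real.log (scale d n) := lt_of_lt_of_le (by positivity) hs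
  have hne : Real.log (scale d n) ≠ 0 := by linarith
  have e : Real.log (∏ i ∈ Finset.range n, p i) / Real.log (scale d n) - α =
      -((∑ i ∈ Finset.range n, (Real.log (p i) + α * Real.log (d i))) /
        -Real.log (scale d n)) := by
    rw [Finset.sum_add_distrib, ← Finset.mul_sum, ← neg_log_scale hd,
      Real.log_prod fun i _ => (hp i).ne']
    field_simp
    ring
  rw [e, norm_neg, norm_div, norm_div, Real.norm_of_nonneg hs0.le, Real.norm_of_nonneg hn0.le,
    div_div]
  gcongr

/-- If the runs of zeros and of maximal digits of `x` have sublinear length and the mass of the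
cylinders around `x` has exponent `α`, then the projected measure has local dimension `α` at the
projection of `x`. -/
lemma mem_Xlev_of_digits {C : ℕ} (hC : ∀ n, d n ≤ C) {p : ℕ → ℕ → ℝ}
    (hp : ∀ n, ∀ k < d n, 0 < p n k ∧ p n k ≤ 1) {α : ℝ}
    {μ : Measure (∀ n, Fin (d n))} [IsProbabilityMeasure μ] (hμ : HasCylinderWeights μ p)
    {m : ℕ → ℕ} (hm : Tendsto (fun n => ((m (n + 1) : ℝ) + 1) / n) atTop (𝓝 0))
    {x : ∀ n, Fin (d n)}
    (hx : Tendsto (fun n : ℕ => (∑ i ∈ Finset.range n,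
      (Real.log (p i (x i)) + α * Real.log (d i))) / n) atTop (𝓝 0))
    (hx0 : ∀ᶠ n in atTop, ∃ j, n ≤ j ∧ j < n + m n ∧ (x j : ℕ) ≠ 0)
    (hx1 : ∀ᶠ n in atTop, ∃ j, n ≤ j ∧ j < n + m n ∧ (x j : ℕ) ≠ d j - 1) :
    (∑' n, ((x n : ℕ) : ℝ) * scale d (n + 1)) ∈
      Xlev (μ.map fun y => ∑' n, ((y n : ℕ) : ℝ) * scale d (n + 1)) α := by
  set γ : (∀ n, Fin (d n)) → ℝ := fun y => ∑' n, ((y n : ℕ) : ℝ) * scale d (n + 1) with hγ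
  have hγm : Measurable γ := measurable_tsum_digits hd
  have hlt : ∀ y : ∀ n, Fin (d n), ∀ n, (y n : ℕ) < d n := fun y n => (y n).2
  set P : ℕ → ℝ := fun n => ∏ i ∈ Finset.range n, p i (x i)
  have hP : ∀ n, 0 < P n := fun n => Finset.prod_pos fun i _ => (hp i _ (x i).2).1
  have hP1 : ∀ n, P n ≤ 1 := fun n => Finset.prod_le_one
    (fun i _ => (hp i _ (x i).2).1.le) fun i _ => (hp i _ (x i).2).2
  have hprefix : ∀ n, μ.real {y | ∀ i < n, y i = x i} = P n := fun n => by
    rw [Measure.real, hμ.measure_prefix, ENNReal.toReal_ofReal (hP n).le]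
  have hball : ∀ r, ((μ.map γ) (closedBall (γ x) r)).toReal =
      μ.real (γ ⁻¹' closedBall (γ x) r) := fun r => by
    rw [Measure.map_apply hγm measurableSet_closedBall, Measure.real]
  have hlow : ∀ n r, scale d n ≤ r → P n ≤ ((μ.map γ) (closedBall (γ x) r)).toReal := by
    intro n r hr
    rw [hball, ← hprefix]
    refine measureReal_mono fun y hy => ?_
    rw [mem_preimage, mem_closedBall, Real.dist_eq]
    exact (abs_tsum_sub_tsum_le hd (hlt x) (hlt y) fun i hi => by rw [hy i hi]).trans hr
  have hup : ∀ᶠ n in atTop, ∀ r, 0 < r → r < scale d (n + m n) →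
      ((μ.map γ) (closedBall (γ x) r)).toReal ≤ P n := by
    filter_upwards [hx0, hx1] with n h0 h1 r _ hr
    rw [hball, ← hprefix]
    refine measureReal_mono fun y hy i hi => Fin.ext ?_
    rw [mem_preimage, mem_closedBall, Real.dist_eq] at hy
    exact digits_eq_of_abs_sub_lt hd (hlt x) (hlt y) h0 h1 (hy.trans_lt hr) i hi
  refine ⟨fun r hr => ?_, ?_⟩
  · obtain ⟨n, hn⟩ := ((tendsto_scale hd).eventually (gt_mem_nhds hr)).exists
    have h1 : 0 < ((μ.map γ) (closedBall (γ x) (scale d n))).toReal :=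
      (hP n).trans_le (hlow n _ le_rfl)
    exact (ENNReal.toReal_pos_iff.1 h1).1.trans_le (measure_mono (closedBall_subset_ball hn))
  · refine tendsto_log_div_log_of_scales (M := fun n => n + m n) (scale_pos hd) (tendsto_scale hd)
      (tendsto_atTop_mono (fun n => Nat.le_add_right n (m n)) tendsto_id) hP hP1 hlow hup
      (tendsto_log_prod_div_log_scale hd (fun n => (hp n _ (x n).2).1) hx)
      (tendsto_log_scale_ratio hd hC (fun n => n.le_succ) ?_)
      (tendsto_log_scale_ratio hd hC (M := fun n => n + 1 + m (n + 1)) (fun n => by omega) ?_)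
    · simpa using tendsto_one_div_atTop_nhds_zero_nat (𝕜 := ℝ)
    · refine hm.congr fun n => ?_
      push_cast
      ring

theorem ae_mem_Xlev {C : ℕ} (hC : ∀ n, d n ≤ C) {p w : ℕ → ℕ → ℝ} {κ ρ α : ℝ} (hκ : 0 < κ)
    (hp : ∀ n, ∀ k < d n, κ ≤ p n k ∧ p n k ≤ 1) (hρ0 : 0 < ρ) (hρ1 : ρ < 1)
    (hw : ∀ n, ∀ k < d n, 0 ≤ w n k ∧ w n k ≤ ρ)
    (hwsum : ∀ n, ∑ k ∈ Finset.range (d n), w n k = 1)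
    (hmean : ∀ n, ∑ k ∈ Finset.range (d n), w n k * Real.log (p n k) = -α * Real.log (d n))
    {μ μt : Measure (∀ n, Fin (d n))} [IsProbabilityMeasure μ] [IsProbabilityMeasure μt]
    (hμ : HasCylinderWeights μ p) (hμt : HasCylinderWeights μt w) :
    ∀ᵐ x ∂μt, (∑' n, ((x n : ℕ) : ℝ) * scale d (n + 1)) ∈
      Xlev (μ.map fun y => ∑' n, ((y n : ℕ) : ℝ) * scale d (n + 1)) α := by
  have h0 : ∀ n, ∀ k < d n, 0 ≤ w n k := fun n k hk => (hw n k hk).1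
  have hpos : ∀ n, 0 < d n := fun n => by have := hd n; omega
  have : ∀ n, IsProbabilityMeasure (digitLaw (d n) (w n)) := fun n =>
    isProbabilityMeasure_digitLaw (h0 n) (hwsum n)
  obtain ⟨m, hm, hm'⟩ := exists_summable_pow_sublinear hρ0 hρ1
  rw [hμt.eq_infinitePi h0]
  have hslln := ae_tendsto_sum_digits_div h0
    (g := fun n k => Real.log (p n k) + α * Real.log (d n))
    (B := -Real.log κ + |α| * Real.log C) (fun n k hk => ?_) fun n => ?_
  · filter_upwards [hslln,
      ae_eventually_exists_ne (fun n k hk => (hw n k hk).2) hm hρ0.le fun n => ⟨0, hpos n⟩,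
      ae_eventually_exists_ne (fun n k hk => (hw n k hk).2) hm hρ0.le
        fun n => ⟨d n - 1, Nat.sub_lt (hpos n) one_pos⟩] with x h1 h2 h3
    refine mem_Xlev_of_digits hd hC (fun n k hk => ⟨hκ.trans_le (hp n k hk).1, (hp n k hk).2⟩)
      hμ hm' h1 ?_ ?_
    · simpa only [ne_eq, Fin.ext_iff] using h2
    · simpa only [ne_eq, Fin.ext_iff] using h3
  · obtain ⟨hp1, hp2⟩ := hp n k hk
    have e1 : Real.log κ ≤ Real.log (p n k) := Real.log_le_log hκ hp1
    have e2 : Real.log (p n k) ≤ 0 := Real.log_nonpos (hκ.le.trans hp1) hp2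
    have e3 : Real.log (d n) ≤ Real.log C :=
      Real.log_le_log (by exact_mod_cast hpos n) (by exact_mod_cast hC n)
    refine (abs_add_le _ _).trans (add_le_add ?_ ?_)
    · rw [abs_of_nonpos e2]
      linarith
    · rw [abs_mul, abs_of_nonneg (Real.log_natCast_nonneg (d n))]
      gcongr
  · simp only [mul_add, Finset.sum_add_distrib]
    rw [hmean, ← Finset.sum_mul, hwsum]
    ring

end LocalDimension

/-! ### The normalized weights -/

section Weights

variable {c : ℕ} (hc : 2 ≤ c) {p : ℕ → ℝ} (hp : ∀ i < c, 0 < p i)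
include hc hp

lemma sum_rpow_pos (q : ℝ) : 0 < ∑ i ∈ Finset.range c, p i ^ q :=
  Finset.sum_pos (fun i hi => Real.rpow_pos_of_pos (hp i (Finset.mem_range.1 hi)) q)
    ⟨0, Finset.mem_range.2 (by omega)⟩

lemma taW_pos (q : ℝ) {i : ℕ} (hi : i < c) : 0 < taW c p q i :=
  div_pos (Real.rpow_pos_of_pos (hp i hi) q) (sum_rpow_pos hc hp q)

lemma sum_taW (q : ℝ) : ∑ i ∈ Finset.range c, taW c p q i = 1 := by
  simp only [taW]
  rw [← Finset.sum_div, div_self (sum_rpow_pos hc hp q).ne']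

lemma sum_taW_mul_log {α q : ℝ} (h : HasDerivAt (theta c p) (-α) q) :
    ∑ i ∈ Finset.range c, taW c p q i * Real.log (p i) = -α * Real.log c := by
  have hlc : Real.log c ≠ 0 := (Real.log_pos (by exact_mod_cast (by omega : 1 < c))).ne'
  have h1 : HasDerivAt (fun t => ∑ i ∈ Finset.range c, p i ^ t)
      (∑ i ∈ Finset.range c, p i ^ q * Real.log (p i)) q :=
    HasDerivAt.fun_sum fun i hi =>
      (Real.hasStrictDerivAt_const_rpow (hp i (Finset.mem_range.1 hi)) q).hasDerivAt
  have h2 := (h1.log (sum_rpow_pos hc hp q).ne').div_const (Real.log c)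
  rw [h.unique h2, div_mul_cancel₀ _ hlc, Finset.sum_div]
  exact Finset.sum_congr rfl fun i _ => by rw [taW, div_mul_eq_mul_div]

end Weights

lemma lt_one_of_sum_eq_one {c : ℕ} (hc : 2 ≤ c) {w : ℕ → ℝ} (hw : ∀ i < c, 0 < w i)
    (hsum : ∑ i ∈ Finset.range c, w i = 1) {i : ℕ} (hi : i < c) : w i < 1 := by
  rw [← hsum]
  have hj : ∃ j < c, j ≠ i := by
    rcases eq_or_ne i 0 with rfl | h
    · exact ⟨1, by omega, one_ne_zero⟩
    · exact ⟨0, by omega, h.symm⟩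
  obtain ⟨j, hjc, hji⟩ := hj
  exact Finset.single_lt_sum hji (Finset.mem_range.2 hi) (Finset.mem_range.2 hjc) (hw j hjc)
    fun k hk _ => (hw k (Finset.mem_range.1 hk)).le

lemma exists_lt_one_forall_le {c : ℕ} {w : ℕ → ℝ} (hw : ∀ i < c, w i < 1) :
    ∃ ρ, 0 < ρ ∧ ρ < 1 ∧ ∀ i < c, w i ≤ ρ := by
  induction c with
  | zero => exact ⟨1 / 2, by norm_num, by norm_num, fun i hi => absurd hi (by omega)⟩
  | succ c ih =>
    obtain ⟨ρ, h0, h1, h2⟩ := ih fun i hi => hw i (by omega)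
    refine ⟨max ρ (w c), lt_max_of_lt_left h0, max_lt h1 (hw c (by omega)), fun i hi => ?_⟩
    rcases Nat.lt_succ_iff_lt_or_eq.1 hi with h | rfl
    · exact (h2 i h).trans (le_max_left _ _)
    · exact le_max_right _ _

lemma exists_pos_forall_le {c : ℕ} {w : ℕ → ℝ} (hw : ∀ i < c, 0 < w i) :
    ∃ κ, 0 < κ ∧ ∀ i < c, κ ≤ w i := by
  obtain ⟨ρ, -, h1, h2⟩ := exists_lt_one_forall_le (c := c) (w := fun i => 1 - w i)
    fun i hi => by linarith [hw i hi]
  exact ⟨1 - ρ, by linarith, fun i hi => by linarith [h2 i hi]⟩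

lemma Dw_eq_scale (c₁ c₂ : ℕ) (T : ℕ → ℕ) (n : ℕ) : Dw c₁ c₂ T n = scale (Yc c₁ c₂ T) n := by
  have hsucc : ∀ n, Ncount T (n + 1) = Ncount T n + if isA T (n + 1) then 1 else 0 := fun n => by
    rw [Ncount, ← Finset.insert_Icc_right_eq_Icc_add_one (by omega), Finset.filter_insert]
    split_ifs with h
    · rw [Finset.card_insert_of_notMem (by simp), Ncount]
    · rfl
  have hle : ∀ n, Ncount T n ≤ n := fun n => by
    simpa [Ncount] using Finset.card_filter_le (Finset.Icc 1 n) (isA T)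
  induction n with
  | zero => simp [Dw, scale, Ncount]
  | succ n ih =>
    rw [scale, Finset.prod_range_succ, ← scale, ← ih, Dw, Dw, hsucc, Yc]
    split_ifs with h
    · rw [Nat.add_sub_add_right, pow_succ, ← mul_inv]
      ring
    · rw [add_zero, Nat.sub_add_comm (hle n), pow_succ, ← mul_inv]
      ring

/-- The level set `X_ν(α)` has full `ν̃_q`-measure. -/
theorem stmt18 (c₁ c₂ : ℕ) (hc₁ : 2 ≤ c₁) (hc₂ : 2 ≤ c₂)
    (T : ℕ → ℕ) (hT1 : T 1 = 1) (hTmono : ∀ k, 1 ≤ k → T k < T (k + 1))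
    (hTrat : Tendsto (fun k => (T (k + 1) : ℝ) / (T k : ℝ)) atTop atTop)
    (a b : ℕ → ℝ) (ha : ∀ i, i < c₁ → 0 < a i ∧ a i < 1)
    (hb : ∀ j, j < c₂ → 0 < b j ∧ b j < 1)
    (hsa : ∑ i ∈ Finset.range c₁, a i = 1) (hsb : ∑ j ∈ Finset.range c₂, b j = 1)
    (α : ℝ) (hα1 : -Real.log (sOne c₁ c₂ a b) < α) (hα2 : α < -Real.log (sTwo c₁ c₂ a b))
    (qa qb : ℝ) (hqa : HasDerivAt (theta c₁ a) (-α) qa)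
    (hqb : HasDerivAt (theta c₂ b) (-α) qb)
    (μ μt : Measure (Omg c₁ c₂ T)) [IsProbabilityMeasure μ] [IsProbabilityMeasure μt]
    (hμ : ∀ (n : ℕ) (w : Word c₁ c₂ T n),
      μ (cyl c₁ c₂ T n w) = ENNReal.ofReal (cylWeight c₁ c₂ T a b n w))
    (hμt : ∀ (n : ℕ) (w : Word c₁ c₂ T n),
      μt (cyl c₁ c₂ T n w) =
        ENNReal.ofReal (cylWeight c₁ c₂ T (taW c₁ a qa) (taW c₂ b qb) n w)) :
    μt.map (gammaMap c₁ c₂ T) (Xlev (μ.map (gammaMap c₁ c₂ T)) α) = 1 := by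
  have ha0 : ∀ i < c₁, 0 < a i := fun i hi => (ha i hi).1
  have hb0 : ∀ j < c₂, 0 < b j := fun j hj => (hb j hj).1
  obtain ⟨κa, hκa, hκa'⟩ := exists_pos_forall_le ha0
  obtain ⟨κb, hκb, hκb'⟩ := exists_pos_forall_le hb0
  obtain ⟨ρa, hρa, hρa1, hρa'⟩ := exists_lt_one_forall_le fun i hi =>
    lt_one_of_sum_eq_one hc₁ (fun i hi => taW_pos hc₁ ha0 qa hi) (sum_taW hc₁ ha0 qa) hi
  obtain ⟨ρb, hρb, hρb1, hρb'⟩ := exists_lt_one_forall_le fun i hi =>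
    lt_one_of_sum_eq_one hc₂ (fun i hi => taW_pos hc₂ hb0 qb hi) (sum_taW hc₂ hb0 qb) hi
  have hd : ∀ n, 2 ≤ Yc c₁ c₂ T n := fun n => by
    unfold Yc
    split_ifs <;> assumption
  have hC : ∀ n, Yc c₁ c₂ T n ≤ max c₁ c₂ := fun n => by
    unfold Yc
    split_ifs
    · exact le_max_left _ _
    · exact le_max_right _ _
  have hγ : gammaMap c₁ c₂ T =
      fun x => ∑' n, ((x n : ℕ) : ℝ) * scale (Yc c₁ c₂ T) (n + 1) := by
    funext x
    simp only [gammaMap, Dw_eq_scale]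
  have hae := ae_mem_Xlev hd hC (p := fun n k => if isA T (n + 1) then a k else b k)
    (w := fun n k => if isA T (n + 1) then taW c₁ a qa k else taW c₂ b qb k)
    (κ := min κa κb) (ρ := max ρa ρb) (α := α) (lt_min hκa hκb) (fun n k hk => ?_)
    (lt_max_of_lt_left hρa) (max_lt hρa1 hρb1) (fun n k hk => ?_) (fun n => ?_) (fun n => ?_)
    hμ hμt
  · have hγm : Measurable (gammaMap c₁ c₂ T) := hγ ▸ measurable_tsum_digits hd
    have := Measure.isProbabilityMeasure_map (μ := μt) hγm.aemeasurable
    refine le_antisymm prob_le_one ?_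
    refine le_trans ?_ (Measure.le_map_apply hγm.aemeasurable _)
    rw [hγ, ← measure_univ (μ := μt)]
    refine measure_mono_ae ?_
    filter_upwards [hae] with x hx _ using hx
  · by_cases h : isA T (n + 1)
    · simp only [Yc, if_pos h] at hk ⊢
      exact ⟨(min_le_left _ _).trans (hκa' k hk), (ha k hk).2.le⟩
    · simp only [Yc, if_neg h] at hk ⊢
      exact ⟨(min_le_right _ _).trans (hκb' k hk), (hb k hk).2.le⟩
  · by_cases h : isA T (n + 1)
    · simp only [Yc, if_pos h] at hk ⊢
      exact ⟨(taW_pos hc₁ ha0 qa hk).le, (hρa' k hk).trans (le_max_left _ _)⟩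
    · simp only [Yc, if_neg h] at hk ⊢
      exact ⟨(taW_pos hc₂ hb0 qb hk).le, (hρb' k hk).trans (le_max_right _ _)⟩
  · by_cases h : isA T (n + 1)
    · simp only [Yc, if_pos h, sum_taW hc₁ ha0 qa]
    · simp only [Yc, if_neg h, sum_taW hc₂ hb0 qb]
  · by_cases h : isA T (n + 1)
    · simp only [Yc, if_pos h, sum_taW_mul_log hc₁ ha0 hqa]
    · simp only [Yc, if_neg h, sum_taW_mul_log hc₂ hb0 hqb]

end MF
end
end
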